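/- arXiv:1803.02658 — 2 statements merged into one kernel-verified Lean document; each statement's English description precedes it below -/
import Mathlib

section
/- Let N ≥ 2 and let a ≥ 0 be a constant. There exist M > 1 and μ ∈ (0,1), depending only on N and a, with the following property: if u : Q₄ → ℝ is a C² function with u ≥ 0 on Q₄, −Δu(x) + a·u(x) ≥ 0 for all x ∈ Q₄, and inf_{x ∈ Q₁} u(x)/x_N ≤ 1, then for every integer j ≥ 1 the Lebesgue measure of {x ∈ Q₁ : u(x)/x_N > M^j} is strictly less than (1−μ)^j. -/
open MeasureTheory Metric Set

/-- The Laplacian of a real-valued function on `ℝ^N`, as the sum of second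
partial derivatives in the coordinate directions. -/
noncomputable def lap {N : ℕ} (u : EuclideanSpace ℝ (Fin N) → ℝ)
    (x : EuclideanSpace ℝ (Fin N)) : ℝ :=
  ∑ i : Fin N, fderiv ℝ (fun y => fderiv ℝ u y (EuclideanSpace.single i 1)) x
    (EuclideanSpace.single i 1)

/-- The open cube `Q_ρ(y)` of center `y` and side length `ρ`. -/
def cube {N : ℕ} (ρ : ℝ) (y : EuclideanSpace ℝ (Fin N)) :
    Set (EuclideanSpace ℝ (Fin N)) :=
  {x | ∀ i : Fin N, |x i - y i| < ρ / 2}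

/-- `u` is `C²`, nonnegative and satisfies `-Δu + a u ≥ 0` on the open set `Ω`. -/
structure IsNonnegSupersolution {N : ℕ} (a : ℝ) (u : EuclideanSpace ℝ (Fin N) → ℝ)
    (Ω : Set (EuclideanSpace ℝ (Fin N))) : Prop where
  isOpen : IsOpen Ω
  contDiffOn : ContDiffOn ℝ 2 u Ω
  nonneg : ∀ x ∈ Ω, 0 ≤ u x
  lap_le : ∀ x ∈ Ω, lap u x ≤ a * u x

/-- The weight `(1 - ‖y‖²)₊`, supported in the closed unit ball. -/
noncomputable def ballWeight {E : Type*} [Norm E] (y : E) : ℝ := max (1 - ‖y‖ ^ 2) 0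

section BallWeight

variable {E : Type*} [NormedAddCommGroup E]

lemma ballWeight_nonneg (y : E) : 0 ≤ ballWeight y := le_max_right _ _

lemma ballWeight_le_one (y : E) : ballWeight y ≤ 1 :=
  max_le (by nlinarith [sq_nonneg ‖y‖]) zero_le_one

lemma ballWeight_eq_zero {y : E} (hy : 1 ≤ ‖y‖) : ballWeight y = 0 :=
  max_eq_right (by nlinarith)

lemma continuous_ballWeight : Continuous (ballWeight : E → ℝ) := by
  unfold ballWeight; fun_prop

lemma hasCompactSupport_ballWeight [ProperSpace E] :
    HasCompactSupport (ballWeight : E → ℝ) :=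
  HasCompactSupport.intro (isCompact_closedBall (0 : E) 1) fun y hy =>
    ballWeight_eq_zero (by simpa using le_of_lt (by simpa using hy))

lemma hasDerivAt_posPart_sq (s : ℝ) :
    HasDerivAt (fun s : ℝ => (max s 0) ^ 2) (2 * max s 0) s := by
  rcases lt_trichotomy s 0 with hs | rfl | hs
  · rw [max_eq_right hs.le, mul_zero]
    refine (hasDerivAt_const s (0 : ℝ)).congr_of_eventuallyEq ?_
    filter_upwards [eventually_lt_nhds hs] with t ht
    simp [max_eq_right ht.le]
  · rw [max_self, mul_zero, hasDerivAt_iff_isLittleO]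
    have h : (fun t : ℝ => (max t 0) ^ 2) =O[nhds 0] fun t => t ^ 2 := by
      refine Asymptotics.IsBigO.of_bound 1 (Filter.Eventually.of_forall fun t => ?_)
      rcases le_total t 0 with ht | ht <;> simp [ht]
      positivity
    simpa using h.trans_isLittleO (Asymptotics.isLittleO_pow_id one_lt_two)
  · rw [max_eq_left hs.le]
    refine HasDerivAt.congr_of_eventuallyEq (f₁ := fun t : ℝ => (max t 0) ^ 2)
      (f := fun t => t ^ 2) (by simpa using hasDerivAt_pow 2 s) ?_
    filter_upwards [eventually_gt_nhds hs] with t ht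
    simp [max_eq_left ht.le]

lemma hasFDerivAt_ballWeight_sq [InnerProductSpace ℝ E] (y : E) :
    HasFDerivAt (fun y : E => ballWeight y ^ 2)
      ((-4 * ballWeight y) • innerSL ℝ y) y := by
  have h1 : HasFDerivAt (fun y : E => 1 - ‖y‖ ^ 2) (-(2 • innerSL ℝ y)) y :=
    (hasStrictFDerivAt_norm_sq y).hasFDerivAt.const_sub 1
  refine ((hasDerivAt_posPart_sq (1 - ‖y‖ ^ 2)).comp_hasFDerivAt y h1).congr_fderiv ?_
  ext z
  simp [ballWeight]
  ring

end BallWeight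

section MeanValue

variable {N : ℕ}

local notation "E" => EuclideanSpace ℝ (Fin N)

lemma integrable_mul_ballWeight_pow {g : E → ℝ} (hg : Continuous g) {k : ℕ} (hk : k ≠ 0) :
    Integrable fun y => g y * ballWeight y ^ k := by
  refine Continuous.integrable_of_hasCompactSupport (hg.mul (continuous_ballWeight.pow k)) ?_
  refine HasCompactSupport.mul_left ?_
  exact hasCompactSupport_ballWeight.comp_left (g := fun s : ℝ => s ^ k) (zero_pow hk)

lemma integral_coord_mul_ballWeight {v : E → ℝ} (hv : ContDiff ℝ 1 v) (i : Fin N) :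
    ∫ y, v y * y i * ballWeight y
      = (1 / 4) * ∫ y, fderiv ℝ v y (EuclideanSpace.single i 1) * ballWeight y ^ 2 := by
  have hd : ∀ y : E, fderiv ℝ (fun y : E => ballWeight y ^ 2) y (EuclideanSpace.single i 1)
      = -4 * (y i * ballWeight y) := by
    intro y
    rw [(hasFDerivAt_ballWeight_sq y).fderiv]
    simp [EuclideanSpace.inner_single_right]
    ring
  have hv' : Continuous fun y => fderiv ℝ v y (EuclideanSpace.single i 1) :=
    (hv.continuous_fderiv one_ne_zero).clm_apply continuous_const
  have key := integral_mul_fderiv_eq_neg_fderiv_mul_of_integrable (μ := volume)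
    (f := v) (g := fun y : E => ballWeight y ^ 2) (v := EuclideanSpace.single i 1)
    (integrable_mul_ballWeight_pow hv' two_ne_zero)
    (by
      simp only [hd]
      have : Continuous fun y : E => -4 * (v y * y i) := by
        have := hv.continuous
        fun_prop
      refine (integrable_mul_ballWeight_pow this one_ne_zero).congr
        (Filter.Eventually.of_forall fun y => ?_)
      simp only [pow_one]; ring)
    (integrable_mul_ballWeight_pow hv.continuous two_ne_zero)
    (fun y _ => hv.differentiable one_ne_zero y)
    (fun y _ => (hasFDerivAt_ballWeight_sq y).differentiableAt)
  simp only [hd] at key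
  have h2 : ∀ y : E, v y * (-4 * (y i * ballWeight y)) = -4 * (v y * y i * ballWeight y) :=
    fun y => by ring
  simp only [h2, integral_const_mul] at key
  linarith

lemma hasDerivAt_integral_ballWeight {u : E → ℝ} (hu : ContDiff ℝ 2 u) (x₀ : E) (r : ℝ) :
    HasDerivAt (fun r : ℝ => ∫ y, u (x₀ + r • y) * ballWeight y)
      (∫ y, fderiv ℝ u (x₀ + r • y) y * ballWeight y) r := by
  have hu' : Continuous (fderiv ℝ u) := hu.continuous_fderiv two_ne_zero
  have huc := hu.continuous
  obtain ⟨C, hC⟩ := (isCompact_closedBall x₀ (|r| + 1)).exists_bound_of_continuousOn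
    hu'.continuousOn
  have hC0 : 0 ≤ C := (norm_nonneg _).trans (hC x₀ (mem_closedBall_self (by positivity)))
  refine (hasDerivAt_integral_of_dominated_loc_of_deriv_le (μ := volume)
    (F := fun (r : ℝ) (y : E) => u (x₀ + r • y) * ballWeight y)
    (F' := fun (r : ℝ) (y : E) => fderiv ℝ u (x₀ + r • y) y * ballWeight y)
    (bound := fun y : E => C * ballWeight y)
    (ball_mem_nhds r one_pos) ?_ ?_ ?_ ?_ ?_ ?_).2
  · refine Filter.Eventually.of_forall fun s => Continuous.aestronglyMeasurable ?_
    exact Continuous.mul (by fun_prop) continuous_ballWeight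
  · simpa using integrable_mul_ballWeight_pow (g := fun y => u (x₀ + r • y)) (by fun_prop)
      one_ne_zero
  · refine Continuous.aestronglyMeasurable ?_
    exact Continuous.mul (by fun_prop) continuous_ballWeight
  · refine Filter.Eventually.of_forall fun y s hs => ?_
    rw [norm_mul, Real.norm_of_nonneg (ballWeight_nonneg y)]
    rcases le_total 1 ‖y‖ with hy | hy
    · simp [ballWeight_eq_zero hy]
    refine mul_le_mul_of_nonneg_right ?_ (ballWeight_nonneg y)
    have hs' : |s| ≤ |r| + 1 := by
      have h1 : |s - r| < 1 := by simpa [Real.dist_eq] using hs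
      have h2 := abs_sub_abs_le_abs_sub s r
      linarith
    have hmem : x₀ + s • y ∈ closedBall x₀ (|r| + 1) := by
      simp only [mem_closedBall, dist_self_add_left, norm_smul, Real.norm_eq_abs]
      nlinarith [abs_nonneg s, norm_nonneg y]
    calc ‖fderiv ℝ u (x₀ + s • y) y‖ ≤ ‖fderiv ℝ u (x₀ + s • y)‖ * ‖y‖ :=
          ContinuousLinearMap.le_opNorm _ _
      _ ≤ C * 1 := mul_le_mul (hC _ hmem) hy (norm_nonneg _) hC0
      _ = C := mul_one C
  · simpa using integrable_mul_ballWeight_pow (N := N) (g := fun _ => C) (by fun_prop) one_ne_zero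
  · refine Filter.Eventually.of_forall fun y s _ => HasDerivAt.mul_const ?_ _
    have h1 : HasDerivAt (fun s : ℝ => x₀ + s • y) y s := by
      simpa using ((hasDerivAt_id s).smul_const y).const_add x₀
    exact ((hu.differentiable two_ne_zero _).hasFDerivAt).comp_hasDerivAt s h1

lemma contDiff_partial {u : E → ℝ} (hu : ContDiff ℝ 2 u) (i : Fin N) :
    ContDiff ℝ 1 fun y => fderiv ℝ u y (EuclideanSpace.single i 1) :=
  (hu.fderiv_right (m := 1) (by norm_num)).clm_apply contDiff_const

lemma continuous_lap {u : E → ℝ} (hu : ContDiff ℝ 2 u) : Continuous (lap u) := by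
  unfold lap
  exact continuous_finsetSum _ fun i _ =>
    ((contDiff_partial hu i).continuous_fderiv one_ne_zero).clm_apply continuous_const

lemma integral_fderiv_mul_ballWeight {u : E → ℝ} (hu : ContDiff ℝ 2 u) (x₀ : E) (r : ℝ) :
    ∫ y, fderiv ℝ u (x₀ + r • y) y * ballWeight y
      = r / 4 * ∫ y, lap u (x₀ + r • y) * ballWeight y ^ 2 := by
  have hexp : ∀ y : E, fderiv ℝ u (x₀ + r • y) y
      = ∑ i, fderiv ℝ u (x₀ + r • y) (EuclideanSpace.single i 1) * y i := by
    intro y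
    have hy : y = ∑ i, y i • (EuclideanSpace.single i (1 : ℝ) : E) := by
      ext j; simp [Pi.single_apply]
    conv_lhs => rw [hy, map_sum]
    rw [← hy]
    simp [mul_comm]
  have hv : ∀ i : Fin N, ContDiff ℝ 1
      fun y : E => fderiv ℝ u (x₀ + r • y) (EuclideanSpace.single i 1) := fun i =>
    (contDiff_partial hu i).comp (by fun_prop : ContDiff ℝ 1 fun y : E => x₀ + r • y)
  have hd : ∀ (i : Fin N) (y : E),
      fderiv ℝ (fun y : E => fderiv ℝ u (x₀ + r • y) (EuclideanSpace.single i 1)) y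
        (EuclideanSpace.single i 1)
      = r * fderiv ℝ (fun y => fderiv ℝ u y (EuclideanSpace.single i 1)) (x₀ + r • y)
        (EuclideanSpace.single i 1) := by
    intro i y
    have h1 : HasFDerivAt (fun y : E => x₀ + r • y) (r • ContinuousLinearMap.id ℝ E) y :=
      ((hasFDerivAt_id y).const_smul r).const_add x₀
    have h2 := ((contDiff_partial hu i).differentiable one_ne_zero (x₀ + r • y)).hasFDerivAt
    have h3 := h2.comp y h1
    rw [show (fun y : E => fderiv ℝ u (x₀ + r • y) (EuclideanSpace.single i 1))
      = (fun y => fderiv ℝ u y (EuclideanSpace.single i 1)) ∘ fun y => x₀ + r • y from rfl,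
      h3.fderiv]
    simp
  have hc : ∀ i : Fin N, Continuous fun y : E =>
      fderiv ℝ (fun y => fderiv ℝ u y (EuclideanSpace.single i 1)) (x₀ + r • y)
        (EuclideanSpace.single i 1) := fun i =>
    (((contDiff_partial hu i).continuous_fderiv one_ne_zero).comp (by fun_prop)).clm_apply
      continuous_const
  simp only [hexp, Finset.sum_mul]
  rw [integral_finsetSum]
  · simp only [integral_coord_mul_ballWeight (hv _), hd, lap, Finset.sum_mul]
    rw [integral_finsetSum]
    · simp only [mul_assoc, integral_const_mul, Finset.mul_sum]
      refine Finset.sum_congr rfl fun i _ => by ring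
    · exact fun i _ => integrable_mul_ballWeight_pow (hc i) two_ne_zero
  · intro i _
    simpa using integrable_mul_ballWeight_pow (g := fun y : E =>
      fderiv ℝ u (x₀ + r • y) (EuclideanSpace.single i 1) * y i)
      ((hv i).continuous.mul (by fun_prop)) one_ne_zero

lemma integral_ballWeight_le {a : ℝ} (ha : 0 ≤ a) {u : E → ℝ} (hu : ContDiff ℝ 2 u) {x₀ : E}
    {R : ℝ} (hR : 0 ≤ R) (hpos : ∀ x ∈ ball x₀ R, 0 ≤ u x)
    (hlap : ∀ x ∈ ball x₀ R, lap u x ≤ a * u x) :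
    ∫ y, u (x₀ + R • y) * ballWeight y
      ≤ Real.exp (a * R ^ 2 / 8) * (u x₀ * ∫ y : E, ballWeight y) := by
  have huc := hu.continuous
  set F : ℝ → ℝ := fun r => ∫ y, u (x₀ + r • y) * ballWeight y with hF
  have hmem : ∀ r ∈ Icc 0 R, ∀ y : E, ‖y‖ < 1 → r < R → x₀ + r • y ∈ ball x₀ R := by
    intro r hr y hy hrR
    simp only [mem_ball, dist_self_add_left, norm_smul, Real.norm_of_nonneg hr.1]
    nlinarith [norm_nonneg y, hr.1, hr.2]
  have hderiv : ∀ r, HasDerivAt F (r / 4 * ∫ y, lap u (x₀ + r • y) * ballWeight y ^ 2) r := by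
    intro r
    rw [← integral_fderiv_mul_ballWeight hu]
    exact hasDerivAt_integral_ballWeight hu x₀ r
  have hle : ∀ r ∈ Ioo 0 R,
      r / 4 * ∫ y, lap u (x₀ + r • y) * ballWeight y ^ 2 ≤ a * r / 4 * F r := by
    intro r hr
    have h1 : ∫ y, lap u (x₀ + r • y) * ballWeight y ^ 2
        ≤ ∫ y, a * (u (x₀ + r • y) * ballWeight y) := by
      refine integral_mono
        (integrable_mul_ballWeight_pow ((continuous_lap hu).comp (by fun_prop)) two_ne_zero)
        (Integrable.const_mul ?_ a) fun y => ?_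
      · simpa using integrable_mul_ballWeight_pow (g := fun y => u (x₀ + r • y)) (by fun_prop)
          one_ne_zero
      · rcases le_or_gt 1 ‖y‖ with hy | hy
        · simp [ballWeight_eq_zero hy]
        have hm := hmem r ⟨hr.1.le, hr.2.le⟩ y hy hr.2
        have hw0 := ballWeight_nonneg y
        have hw1 := ballWeight_le_one y
        calc lap u (x₀ + r • y) * ballWeight y ^ 2
            ≤ a * u (x₀ + r • y) * ballWeight y ^ 2 :=
              mul_le_mul_of_nonneg_right (hlap _ hm) (by positivity)
          _ ≤ a * u (x₀ + r • y) * ballWeight y := by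
              refine mul_le_mul_of_nonneg_left ?_ (mul_nonneg ha (hpos _ hm))
              nlinarith
          _ = a * (u (x₀ + r • y) * ballWeight y) := by ring
    rw [integral_const_mul] at h1
    have h2 := mul_le_mul_of_nonneg_left h1 (by linarith [hr.1] : 0 ≤ r / 4)
    calc _ ≤ _ := h2
      _ = a * r / 4 * F r := by ring
  have hG : ∀ r, HasDerivAt (fun r => Real.exp (-(a * r ^ 2 / 8)) * F r)
      (Real.exp (-(a * r ^ 2 / 8)) * (r / 4 * (∫ y, lap u (x₀ + r • y) * ballWeight y ^ 2)
        - a * r / 4 * F r)) r := by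
    intro r
    have h1 : HasDerivAt (fun r : ℝ => -(a * r ^ 2 / 8)) (-(a * r / 4)) r := by
      have := (((hasDerivAt_pow 2 r).const_mul a).div_const 8).neg
      refine this.congr_deriv ?_
      norm_num; ring
    refine (h1.exp.mul (hderiv r)).congr_deriv ?_
    ring
  have hanti : AntitoneOn (fun r => Real.exp (-(a * r ^ 2 / 8)) * F r) (Icc 0 R) := by
    refine antitoneOn_of_deriv_nonpos (convex_Icc 0 R)
      (fun r _ => (hG r).continuousAt.continuousWithinAt)
      (fun r _ => (hG r).differentiableAt.differentiableWithinAt) fun r hr => ?_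
    rw [interior_Icc] at hr
    rw [(hG r).deriv]
    exact mul_nonpos_of_nonneg_of_nonpos (Real.exp_pos _).le (by linarith [hle r hr])
  have h := hanti ⟨le_rfl, hR⟩ ⟨hR, le_rfl⟩ hR
  have hF0 : F 0 = u x₀ * ∫ y : E, ballWeight y := by
    simp [hF, integral_const_mul]
  simp only [hF0] at h
  norm_num at h
  have h2 := mul_le_mul_of_nonneg_left h (Real.exp_pos (a * R ^ 2 / 8)).le
  rw [← mul_assoc, ← Real.exp_add] at h2
  simpa using h2

lemma integral_ballWeight_nonneg : 0 ≤ ∫ y : E, ballWeight y :=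
  integral_nonneg ballWeight_nonneg

/-- The constant in the mean value inequality on balls of radius at most `2`. -/
noncomputable def meanValueConst (d : ℕ) (a : ℝ) : ℝ :=
  Real.exp (a / 2) * 2 ^ (d + 1) * ∫ y : EuclideanSpace ℝ (Fin d), ballWeight y

lemma meanValueConst_nonneg (a : ℝ) : 0 ≤ meanValueConst N a :=
  mul_nonneg (by positivity) integral_ballWeight_nonneg

/-- Mean value inequality for nonnegative supersolutions of `-Δu + a u = 0`, for a function
which is smooth on the whole space. -/
lemma lintegral_ball_le_of_contDiff {a : ℝ} (ha : 0 ≤ a) {u : E → ℝ} (hu : ContDiff ℝ 2 u) {x₀ : E}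
    {ρ R : ℝ} (hρ : 0 < ρ) (hρR : ρ < R) (hR2 : R ≤ 2) (hpos : ∀ x ∈ ball x₀ R, 0 ≤ u x)
    (hlap : ∀ x ∈ ball x₀ R, lap u x ≤ a * u x) :
    ENNReal.ofReal (R - ρ) * ∫⁻ x in ball x₀ ρ, ENNReal.ofReal (u x)
      ≤ ENNReal.ofReal (meanValueConst N a * u x₀) := by
  have hR : 0 < R := hρ.trans hρR
  have huc := hu.continuous
  have h1 := integral_ballWeight_le ha hu hR.le hpos hlap
  set f : E → ℝ := fun x => u x * ballWeight (R⁻¹ • (x - x₀)) with hf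
  have hwc : Continuous fun x : E => ballWeight (R⁻¹ • (x - x₀)) :=
    continuous_ballWeight.comp (by fun_prop)
  have hout : ∀ x ∉ ball x₀ R, ballWeight (R⁻¹ • (x - x₀)) = 0 := by
    intro x hx
    refine ballWeight_eq_zero ?_
    rw [mem_ball, not_lt, dist_eq_norm] at hx
    rw [norm_smul, norm_inv, Real.norm_of_nonneg hR.le, inv_mul_eq_div, one_le_div hR]
    exact hx
  have hf0 : ∀ x, 0 ≤ f x := by
    intro x
    by_cases hx : x ∈ ball x₀ R
    · exact mul_nonneg (hpos x hx) (ballWeight_nonneg _)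
    · simp [hf, hout x hx]
  have hfint : Integrable f := by
    refine Continuous.integrable_of_hasCompactSupport (huc.mul hwc) ?_
    refine HasCompactSupport.intro (isCompact_closedBall x₀ R) fun x hx => ?_
    simp only [hf, hout x fun h => hx (ball_subset_closedBall h), mul_zero]
  have hchange : ∫ x, f x = R ^ N * ∫ y, u (x₀ + R • y) * ballWeight y := by
    have h2 := Measure.integral_comp_smul (μ := (volume : Measure E)) (fun z => f (x₀ + z)) R
    rw [integral_add_left_eq_self f x₀] at h2
    have h3 : ∀ y : E, f (x₀ + R • y) = u (x₀ + R • y) * ballWeight y := by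
      intro y
      simp [hf, smul_smul, inv_mul_cancel₀ hR.ne']
    simp only [h3] at h2
    rw [h2, finrank_euclideanSpace_fin, abs_of_pos (by positivity), smul_eq_mul, ← mul_assoc,
      mul_inv_cancel₀ (by positivity), one_mul]
  have hux : 0 ≤ u x₀ := hpos x₀ (mem_ball_self hR)
  have hI := integral_ballWeight_nonneg (N := N)
  have htotal : ∫ x, f x ≤ Real.exp (a / 2) * 2 ^ N * ((∫ y : E, ballWeight y) * u x₀) := by
    rw [hchange]
    calc R ^ N * ∫ y, u (x₀ + R • y) * ballWeight y
        ≤ R ^ N * (Real.exp (a * R ^ 2 / 8) * (u x₀ * ∫ y : E, ballWeight y)) := by gcongr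
      _ ≤ 2 ^ N * (Real.exp (a / 2) * (u x₀ * ∫ y : E, ballWeight y)) := by
          have hexp : a * R ^ 2 / 8 ≤ a / 2 := by
            nlinarith [mul_nonneg ha (by nlinarith : 0 ≤ 4 - R ^ 2)]
          gcongr
      _ = _ := by ring
  have hlow : ∀ x ∈ ball x₀ ρ, ENNReal.ofReal (R - ρ) * ENNReal.ofReal (u x)
      ≤ ENNReal.ofReal (2 * f x) := by
    intro x hx
    have hx' : ‖x - x₀‖ < ρ := by simpa [dist_eq_norm] using hx
    have hux' : 0 ≤ u x := hpos x (ball_subset_ball hρR.le hx)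
    rw [← ENNReal.ofReal_mul (by linarith)]
    refine ENNReal.ofReal_le_ofReal ?_
    have hw : (R - ρ) / 2 ≤ ballWeight (R⁻¹ • (x - x₀)) := by
      refine le_trans ?_ (le_max_left _ _)
      rw [norm_smul, norm_inv, Real.norm_of_nonneg hR.le, mul_pow, inv_pow]
      have h4 : ‖x - x₀‖ ^ 2 ≤ ρ * R := by nlinarith [norm_nonneg (x - x₀)]
      have h5 : (R ^ 2)⁻¹ * ‖x - x₀‖ ^ 2 ≤ ρ / R := by
        calc (R ^ 2)⁻¹ * ‖x - x₀‖ ^ 2 ≤ (R ^ 2)⁻¹ * (ρ * R) := by gcongr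
          _ = ρ / R := by field_simp
      have h6 : (R - ρ) / 2 ≤ 1 - ρ / R := by
        rw [one_sub_div hR.ne']
        exact div_le_div_of_nonneg_left (by linarith) hR hR2
      linarith
    simp only [hf]
    nlinarith
  calc ENNReal.ofReal (R - ρ) * ∫⁻ x in ball x₀ ρ, ENNReal.ofReal (u x)
      = ∫⁻ x in ball x₀ ρ, ENNReal.ofReal (R - ρ) * ENNReal.ofReal (u x) :=
        (lintegral_const_mul _ (by fun_prop)).symm
    _ ≤ ∫⁻ x in ball x₀ ρ, ENNReal.ofReal (2 * f x) :=
        setLIntegral_mono' measurableSet_ball hlow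
    _ ≤ ∫⁻ x, ENNReal.ofReal (2 * f x) := setLIntegral_le_lintegral _ _
    _ = ENNReal.ofReal (∫ x, 2 * f x) :=
        (ofReal_integral_eq_lintegral_ofReal (hfint.const_mul 2)
          (Filter.Eventually.of_forall fun x => mul_nonneg zero_le_two (hf0 x))).symm
    _ ≤ _ := by
        refine ENNReal.ofReal_le_ofReal ?_
        rw [integral_const_mul, meanValueConst, pow_succ]
        linarith

lemma Filter.EventuallyEq.lap_eq {u v : E → ℝ} {x : E} (h : u =ᶠ[nhds x] v) :
    lap u x = lap v x := by
  unfold lap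
  refine Finset.sum_congr rfl fun i _ => ?_
  have h1 : (fun y => fderiv ℝ u y (EuclideanSpace.single i 1))
      =ᶠ[nhds x] fun y => fderiv ℝ v y (EuclideanSpace.single i 1) :=
    (h.fderiv (𝕜 := ℝ)).mono fun y hy => by simp only [hy]
  rw [h1.fderiv_eq]

/-- Mean value inequality for nonnegative supersolutions of `-Δu + a u = 0` on an open set. -/
lemma IsNonnegSupersolution.lintegral_ball_le {a : ℝ} (ha : 0 ≤ a) {u : E → ℝ} {Ω : Set E}
    (h : IsNonnegSupersolution a u Ω)
    {x₀ : E} {ρ R R' : ℝ} (hρ : 0 < ρ) (hρR : ρ < R) (hR2 : R ≤ 2) (hRR' : R < R')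
    (hball : ball x₀ R' ⊆ Ω) :
    ENNReal.ofReal (R - ρ) * ∫⁻ x in ball x₀ ρ, ENNReal.ofReal (u x)
      ≤ ENNReal.ofReal (meanValueConst N a * u x₀) := by
  obtain ⟨hΩ, hu, hpos, hlap⟩ := h
  let χ : ContDiffBump x₀ := ⟨R, (R + R') / 2, hρ.trans hρR, by linarith⟩
  have hχu : ContDiff ℝ 2 fun x => χ x * u x := by
    rw [contDiff_iff_contDiffAt]
    intro x
    by_cases hx : x ∈ Ω
    · exact χ.contDiff.contDiffAt.mul (hu.contDiffAt (hΩ.mem_nhds hx))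
    · have hx' : x ∉ tsupport χ := by
        rw [χ.tsupport_eq]
        exact fun h => hx (hball (closedBall_subset_ball (by change (R + R') / 2 < R'; linarith) h))
      refine (contDiffAt_const (c := (0 : ℝ))).congr_of_eventuallyEq ?_
      filter_upwards [notMem_tsupport_iff_eventuallyEq.1 hx'] with y hy
      simp [hy]
  have heq : ∀ x ∈ closedBall x₀ R, χ x * u x = u x := fun x hx => by
    rw [χ.one_of_mem_closedBall hx, one_mul]
  have hsub : ball x₀ R ⊆ Ω := (ball_subset_ball hRR'.le).trans hball
  have key := lintegral_ball_le_of_contDiff ha hχu hρ hρR hR2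
    (fun x hx => by rw [heq x (ball_subset_closedBall hx)]; exact hpos x (hsub hx))
    (fun x hx => by
      have h1 : (fun x => χ x * u x) =ᶠ[nhds x] u := by
        filter_upwards [isOpen_ball.mem_nhds hx] with y hy
        exact heq y (ball_subset_closedBall hy)
      rw [h1.lap_eq, heq x (ball_subset_closedBall hx)]
      exact hlap x (hsub hx))
  rw [heq x₀ (mem_closedBall_self (hρ.trans hρR).le)] at key
  rwa [setLIntegral_congr_fun measurableSet_ball fun x hx => by
    rw [heq x (ball_subset_closedBall (ball_subset_ball hρR.le hx))]] at key

end MeanValue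

section Barrier

variable {N : ℕ}

local notation "E" => EuclideanSpace ℝ (Fin N)

lemma deriv_deriv_nonneg_of_isLocalMin {f : ℝ → ℝ} {t : ℝ} (hf : ContinuousAt f t)
    (hmin : IsLocalMin f t) : 0 ≤ deriv (deriv f) t := by
  by_contra! hneg
  have hmax := isLocalMax_of_deriv_deriv_neg hneg hmin.deriv_eq_zero hf
  have hconst : f =ᶠ[nhds t] fun _ => f t := by
    filter_upwards [hmin, hmax] with s h1 h2 using le_antisymm h2 h1
  have h0 : deriv (deriv f) t = 0 := by
    rw [hconst.deriv.deriv_eq]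
    simp
  exact hneg.ne h0

lemma lap_nonneg_of_isLocalMin {f : E → ℝ} {p : E} (hf : ContDiffAt ℝ 2 f p)
    (hmin : IsLocalMin f p) : 0 ≤ lap f p := by
  refine Finset.sum_nonneg fun i _ => ?_
  set e : E := EuclideanSpace.single i 1
  have hline : ∀ t : ℝ, HasDerivAt (fun t : ℝ => p + t • e) e t := fun t => by
    simpa using ((hasDerivAt_id t).smul_const e).const_add p
  have hcont : Filter.Tendsto (fun t : ℝ => p + t • e) (nhds 0) (nhds p) := by
    have := (hline 0).continuousAt.tendsto
    simpa using this
  have hdiff : ∀ᶠ y in nhds p, DifferentiableAt ℝ f y :=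
    (hf.eventually (by simp)).mono fun y hy => hy.differentiableAt two_ne_zero
  have h1 : deriv (fun t : ℝ => f (p + t • e)) =ᶠ[nhds 0] fun t => fderiv ℝ f (p + t • e) e := by
    filter_upwards [hcont.eventually hdiff] with t ht
    exact (ht.hasFDerivAt.comp_hasDerivAt t (hline t)).deriv
  have h2 : DifferentiableAt ℝ (fun y => fderiv ℝ f y e) p :=
    ((hf.fderiv_right (m := 1) (by norm_num)).differentiableAt one_ne_zero).clm_apply
      (differentiableAt_const e)
  have h3 : HasDerivAt (fun t : ℝ => fderiv ℝ f (p + t • e) e)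
      (fderiv ℝ (fun y => fderiv ℝ f y e) p e) 0 := by
    have h4 : HasFDerivAt (fun y => fderiv ℝ f y e) (fderiv ℝ (fun y => fderiv ℝ f y e) p)
        (p + (0 : ℝ) • e) := by simpa using h2.hasFDerivAt
    exact h4.comp_hasDerivAt 0 (hline 0)
  have h5 : deriv (deriv fun t : ℝ => f (p + t • e)) 0 =
      fderiv ℝ (fun y => fderiv ℝ f y e) p e := by
    rw [h1.deriv_eq, h3.deriv]
  rw [← h5]
  refine deriv_deriv_nonneg_of_isLocalMin ?_ ?_
  · have : ContinuousAt f (p + (0 : ℝ) • e) := by simpa using hf.continuousAt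
    exact ContinuousAt.comp' (g := f) (f := fun t : ℝ => p + t • e) this (hline 0).continuousAt
  · have := hcont.eventually hmin
    simpa [IsLocalMin, IsMinFilter] using this

lemma lap_sub_const_mul {f g : E → ℝ} {p : E} (hf : ContDiffAt ℝ 2 f p) (hg : ContDiffAt ℝ 2 g p)
    (c : ℝ) : lap (fun x => f x - c * g x) p = lap f p - c * lap g p := by
  have hdiff : ∀ {h : E → ℝ}, ContDiffAt ℝ 2 h p → ∀ᶠ y in nhds p, DifferentiableAt ℝ h y :=
    fun hh => (hh.eventually (by simp)).mono fun y hy => hy.differentiableAt two_ne_zero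
  have hpart : ∀ {h : E → ℝ}, ContDiffAt ℝ 2 h p → ∀ i : Fin N,
      DifferentiableAt ℝ (fun y => fderiv ℝ h y (EuclideanSpace.single i 1)) p := fun hh i =>
    ((hh.fderiv_right (m := 1) (by norm_num)).differentiableAt one_ne_zero).clm_apply
      (differentiableAt_const _)
  unfold lap
  rw [Finset.mul_sum, ← Finset.sum_sub_distrib]
  refine Finset.sum_congr rfl fun i _ => ?_
  have h1 : (fun y => fderiv ℝ (fun x => f x - c * g x) y (EuclideanSpace.single i 1))
      =ᶠ[nhds p] fun y => fderiv ℝ f y (EuclideanSpace.single i 1)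
        - c * fderiv ℝ g y (EuclideanSpace.single i 1) := by
    filter_upwards [hdiff hf, hdiff hg] with y hfy hgy
    rw [(hfy.hasFDerivAt.fun_sub (hgy.hasFDerivAt.const_mul c)).fderiv]
    simp
  rw [h1.fderiv_eq,
    ((hpart hf i).hasFDerivAt.fun_sub ((hpart hg i).hasFDerivAt.const_mul c)).fderiv]
  simp

lemma lap_gaussian (K b : ℝ) (z x : E) :
    lap (fun x : E => Real.exp (-K * ‖x - z‖ ^ 2) - b) x
      = (4 * K ^ 2 * ‖x - z‖ ^ 2 - 2 * K * N) * Real.exp (-K * ‖x - z‖ ^ 2) := by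
  have hexp : ∀ x : E, HasFDerivAt (fun x : E => Real.exp (-K * ‖x - z‖ ^ 2))
      ((-2 * K * Real.exp (-K * ‖x - z‖ ^ 2)) • innerSL ℝ (x - z)) x := by
    intro x
    have h1 : HasFDerivAt (fun x : E => x - z) (ContinuousLinearMap.id ℝ E) x :=
      (hasFDerivAt_id x).sub_const z
    have h2 := ((hasStrictFDerivAt_norm_sq (x - z)).hasFDerivAt.comp x h1).const_mul (-K)
    refine h2.exp.congr_fderiv ?_
    ext y
    simp
    ring
  have hfst : ∀ (i : Fin N) (x : E),
      fderiv ℝ (fun x : E => Real.exp (-K * ‖x - z‖ ^ 2) - b) x (EuclideanSpace.single i 1)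
      = -2 * K * (Real.exp (-K * ‖x - z‖ ^ 2) * (x i - z i)) := by
    intro i x
    rw [((hexp x).sub_const b).fderiv]
    simp [EuclideanSpace.inner_single_right]
    ring
  have hsnd : ∀ i : Fin N,
      fderiv ℝ (fun y => fderiv ℝ (fun x : E => Real.exp (-K * ‖x - z‖ ^ 2) - b) y
        (EuclideanSpace.single i 1)) x (EuclideanSpace.single i 1)
      = (4 * K ^ 2 * (x i - z i) ^ 2 - 2 * K) * Real.exp (-K * ‖x - z‖ ^ 2) := by
    intro i
    simp only [hfst]
    have hproj : HasFDerivAt (fun x : E => x i - z i) (EuclideanSpace.proj i : E →L[ℝ] ℝ) x :=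
      (EuclideanSpace.proj i : E →L[ℝ] ℝ).hasFDerivAt.sub_const (z i)
    rw [(((hexp x).fun_mul hproj).const_mul (-2 * K)).fderiv]
    simp [EuclideanSpace.inner_single_right]
    ring
  unfold lap
  simp only [hsnd]
  rw [← Finset.sum_mul, Finset.sum_sub_distrib, ← Finset.mul_sum, EuclideanSpace.real_norm_sq_eq]
  simp
  ring

/-- Quantitative Hopf lemma on a ball: a nonnegative supersolution which is at least `m` on the
ball of radius `1/2` dominates a multiple of a Gaussian barrier on a larger ball. -/
lemma IsNonnegSupersolution.barrier_le {a : ℝ} (ha : 0 ≤ a) {u : E → ℝ} {Ω : Set E}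
    (h : IsNonnegSupersolution a u Ω)
    {z : E} {ρ m : ℝ} (hm : 0 < m) (hρ : 0 < ρ) (hsub : closedBall z ρ ⊆ Ω)
    (hmin : ∀ x ∈ closedBall z (1 / 2), m ≤ u x) {x : E} (hx : x ∈ closedBall z ρ) :
    m * (Real.exp (-(2 * N + a + 1) * ‖x - z‖ ^ 2) - Real.exp (-(2 * N + a + 1) * ρ ^ 2))
      ≤ u x := by
  obtain ⟨hΩ, hu, hpos, hlap⟩ := h
  set K : ℝ := 2 * N + a + 1 with hK
  have hN : (0 : ℝ) ≤ N := N.cast_nonneg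
  have hK1 : 1 ≤ K := by linarith
  set b : E → ℝ := fun x => Real.exp (-K * ‖x - z‖ ^ 2) - Real.exp (-K * ρ ^ 2) with hb
  have hbC : ContDiff ℝ 2 b := by
    have : ContDiff ℝ 2 fun x : E => ‖x - z‖ ^ 2 := (contDiff_id.sub contDiff_const).norm_sq ℝ
    exact ((contDiff_const.mul this).exp).sub contDiff_const
  have hcont : ContinuousOn (fun x => u x - m * b x) (closedBall z ρ) :=
    (hu.continuousOn.mono hsub).sub (continuous_const.mul hbC.continuous).continuousOn
  obtain ⟨p, hp, hpmin⟩ := (isCompact_closedBall z ρ).exists_isMinOn ⟨x, hx⟩ hcont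
  suffices h : 0 ≤ u p - m * b p by
    have := hpmin hx
    simp only [mem_ofPred_eq] at this
    linarith
  by_contra! hneg
  have hup := hpos p (hsub hp)
  have hbpos : 0 < b p := by
    by_contra! h
    nlinarith
  have hp2 : 1 / 2 < ‖p - z‖ := by
    by_contra! h
    have h1 := hmin p (by simpa [dist_eq_norm] using h)
    have h2 : b p ≤ 1 := by
      have h3 : Real.exp (-K * ‖p - z‖ ^ 2) ≤ 1 :=
        Real.exp_le_one_iff.2 (by nlinarith [sq_nonneg ‖p - z‖])
      have h4 := Real.exp_pos (-K * ρ ^ 2)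
      simp only [hb]; linarith
    nlinarith
  have hpρ : p ∈ ball z ρ := by
    rw [mem_ball, dist_eq_norm]
    have h1 : -K * ρ ^ 2 < -K * ‖p - z‖ ^ 2 := by
      rw [← Real.exp_lt_exp]; simp only [hb] at hbpos; linarith
    have h2 : ‖p - z‖ ^ 2 < ρ ^ 2 := by nlinarith
    exact lt_of_pow_lt_pow_left₀ 2 hρ.le h2
  have huAt : ContDiffAt ℝ 2 u p := hu.contDiffAt (hΩ.mem_nhds (hsub hp))
  have hloc : IsLocalMin (fun x => u x - m * b x) p :=
    (hpmin.isLocalMin (Filter.mem_of_superset (isOpen_ball.mem_nhds hpρ) ball_subset_closedBall))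
  have hl := lap_nonneg_of_isLocalMin
    (huAt.sub (contDiffAt_const.mul hbC.contDiffAt)) hloc
  rw [lap_sub_const_mul huAt hbC.contDiffAt, hb, lap_gaussian] at hl
  have hul := hlap p (hsub hp)
  have hG := Real.exp_pos (-K * ‖p - z‖ ^ 2)
  have hcoef : a < 4 * K ^ 2 * ‖p - z‖ ^ 2 - 2 * K * N := by
    have h1 : 1 < 4 * ‖p - z‖ ^ 2 := by nlinarith
    have h2 : K ^ 2 ≤ 4 * K ^ 2 * ‖p - z‖ ^ 2 := by nlinarith [sq_nonneg K]
    have h3 : K ^ 2 - 2 * K * N = K * (a + 1) := by rw [hK]; ring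
    nlinarith
  have hbe : b p ≤ Real.exp (-K * ‖p - z‖ ^ 2) := by
    have := Real.exp_pos (-K * ρ ^ 2)
    simp only [hb]; linarith
  have h1 : a * u p ≤ a * (m * b p) := mul_le_mul_of_nonneg_left (by linarith) ha
  have h2 : a * (m * b p) ≤ m * (a * Real.exp (-K * ‖p - z‖ ^ 2)) := by
    nlinarith [mul_nonneg (mul_nonneg ha hm.le) (sub_nonneg.2 hbe)]
  have h3 : m * (a * Real.exp (-K * ‖p - z‖ ^ 2))
      < m * ((4 * K ^ 2 * ‖p - z‖ ^ 2 - 2 * K * N) * Real.exp (-K * ‖p - z‖ ^ 2)) := by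
    gcongr
  linarith

end Barrier

section Cubes

variable {N : ℕ}

local notation "E" => EuclideanSpace ℝ (Fin N)

lemma isOpen_cube (ρ : ℝ) (y : E) : IsOpen (cube ρ y) := by
  have : cube ρ y = ⋂ i, {x : E | |x i - y i| < ρ / 2} := by ext; simp [cube]
  rw [this]
  exact isOpen_iInter_of_finite fun i => isOpen_lt (by fun_prop) continuous_const

lemma ball_subset_cube {ρ r s : ℝ} {x y : E} (hx : ∀ i, |x i - y i| ≤ s)
    (hs : s + r ≤ ρ / 2) : ball x r ⊆ cube ρ y := by
  intro z hz i
  have h1 : |z i - x i| < r := by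
    have := PiLp.norm_apply_le (z - x) i
    rw [mem_ball, dist_eq_norm] at hz
    simpa using this.trans_lt hz
  have h2 := abs_sub_le (z i) (x i) (y i)
  linarith [hx i]

/-- The closed cube of side length `2` about the point at height `3/2`. -/
def coreCube (n : Fin N) : Set E :=
  {x | ∀ i, |x i - (EuclideanSpace.single n (3 / 2 : ℝ) : E) i| ≤ 1}

lemma isCompact_coreCube (n : Fin N) : IsCompact (coreCube n) := by
  have h : coreCube n = (fun v : Fin N → ℝ => WithLp.toLp 2 v) ''
      (closedBall (EuclideanSpace.single n (3 / 2 : ℝ) : E).ofLp 1) := by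
    ext x
    simp only [coreCube, mem_image, mem_closedBall, dist_pi_le_iff zero_le_one, Real.dist_eq]
    exact ⟨fun hx => ⟨x.ofLp, hx, rfl⟩, by rintro ⟨v, hv, rfl⟩; exact hv⟩
  rw [h]
  exact (isCompact_closedBall _ _).image (PiLp.continuous_toLp 2 _)

lemma convex_coreCube (n : Fin N) : Convex ℝ (coreCube n) := by
  intro x hx y hy s t hs ht hst i
  set c := (EuclideanSpace.single n (3 / 2 : ℝ) : E) i
  have h1 : (s • x + t • y) i - c = s * (x i - c) + t * (y i - c) := by
    simp only [PiLp.add_apply, PiLp.smul_apply, smul_eq_mul]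
    linear_combination c * hst
  rw [h1]
  calc |s * (x i - c) + t * (y i - c)| ≤ |s * (x i - c)| + |t * (y i - c)| := abs_add_le _ _
    _ = s * |x i - c| + t * |y i - c| := by
      rw [abs_mul, abs_mul, abs_of_nonneg hs, abs_of_nonneg ht]
    _ ≤ s * 1 + t * 1 := by gcongr; exacts [hx i, hy i]
    _ = 1 := by linarith

lemma ball_subset_of_mem_coreCube {n : Fin N} {x : E} (hx : x ∈ coreCube n) :
    ball x (1 / 2) ⊆ cube 4 (EuclideanSpace.single n 2) := by
  refine ball_subset_cube (s := 3 / 2) (fun i => ?_) (by norm_num)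
  have h1 := hx i
  rcases eq_or_ne i n with rfl | hi
  · simp only [PiLp.single_apply, if_true, abs_le] at *
    constructor <;> linarith [h1.1, h1.2]
  · simp only [PiLp.single_apply, if_neg hi] at *
    linarith

end Cubes

section Chain

variable {N : ℕ}

local notation "E" => EuclideanSpace ℝ (Fin N)

/-- The factor lost when comparing integrals over neighbouring balls of radius `1/16`. -/
noncomputable def chainConst (d : ℕ) (a : ℝ) : ENNReal :=
  (ENNReal.ofReal (3 / 16) * volume (ball (0 : EuclideanSpace ℝ (Fin d)) (1 / 16)))⁻¹ *
    ENNReal.ofReal (meanValueConst d a)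

lemma chainConst_ne_top (a : ℝ) : chainConst N a ≠ ⊤ := by
  refine ENNReal.mul_ne_top (ENNReal.inv_ne_top.2 (mul_ne_zero ?_ ?_)) ENNReal.ofReal_ne_top
  · simp
  · exact (measure_ball_pos volume _ (by norm_num)).ne'

lemma IsNonnegSupersolution.lintegral_ball_le_chainConst_mul {a : ℝ} (ha : 0 ≤ a) {u : E → ℝ}
    {Ω : Set E} (h : IsNonnegSupersolution a u Ω) {p q : E} (hpq : dist p q ≤ 1 / 16)
    (hp : ball p (1 / 2) ⊆ Ω) :
    ∫⁻ x in ball q (1 / 16), ENNReal.ofReal (u x)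
      ≤ chainConst N a * ∫⁻ x in ball p (1 / 16), ENNReal.ofReal (u x) := by
  have hz : ∀ z ∈ ball p (1 / 16),
      ENNReal.ofReal (3 / 16) * ∫⁻ x in ball q (1 / 16), ENNReal.ofReal (u x)
        ≤ ENNReal.ofReal (meanValueConst N a) * ENNReal.ofReal (u z) := by
    intro z hz
    have hzp : dist z p < 1 / 16 := hz
    have h1 := h.lintegral_ball_le ha (x₀ := z) (ρ := 3 / 16) (R := 6 / 16) (R' := 7 / 16)
      (by norm_num) (by norm_num) (by norm_num) (by norm_num)
      ((ball_subset_ball' (by linarith)).trans hp)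
    rw [ENNReal.ofReal_mul (meanValueConst_nonneg a)] at h1
    refine le_trans ?_ h1
    norm_num only
    refine mul_le_mul_right (lintegral_mono_set (ball_subset_ball' ?_)) _
    have := dist_triangle_right q z p
    rw [dist_comm q p] at this
    linarith
  have h2 := setLIntegral_mono' (μ := volume) measurableSet_ball hz
  rw [setLIntegral_const, lintegral_const_mul' _ _ ENNReal.ofReal_ne_top,
    Measure.addHaar_ball_center] at h2
  unfold chainConst
  rw [mul_assoc, mul_comm (_⁻¹), ← div_eq_mul_inv, ENNReal.le_div_iff_mul_le]
  · refine le_trans (le_of_eq ?_) h2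
    ring
  · left
    exact mul_ne_zero (by simp) (measure_ball_pos volume _ (by norm_num)).ne'
  · left
    exact ENNReal.mul_ne_top ENNReal.ofReal_ne_top measure_ball_lt_top.ne

lemma IsNonnegSupersolution.lintegral_ball_le_pow_mul {a : ℝ} (ha : 0 ≤ a) {u : E → ℝ}
    {Ω S : Set E} (h : IsNonnegSupersolution a u Ω) (hS : Convex ℝ S)
    (hSΩ : ∀ p ∈ S, ball p (1 / 2) ⊆ Ω) {p : E} (hp : p ∈ S) (k : ℕ) :
    ∀ q ∈ S, dist p q ≤ k / 16 →
      ∫⁻ x in ball q (1 / 16), ENNReal.ofReal (u x)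
        ≤ chainConst N a ^ k * ∫⁻ x in ball p (1 / 16), ENNReal.ofReal (u x) := by
  induction k with
  | zero =>
    intro q _ hpq
    have : p = q := dist_le_zero.1 (by simpa using hpq)
    simp [this]
  | succ k ih =>
    intro q hq hpq
    push_cast at hpq
    set s : ℝ := 1 / (k + 1) with hs
    have hk : (0 : ℝ) < k + 1 := by positivity
    have hs0 : 0 ≤ s := by positivity
    have hs1 : s ≤ 1 := by rw [hs, div_le_one hk]; linarith [k.cast_nonneg (α := ℝ)]
    set q' : E := AffineMap.lineMap q p s with hq'
    have hq'S : q' ∈ S := hS.lineMap_mem hq hp ⟨hs0, hs1⟩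
    have hdq : dist q' q ≤ 1 / 16 := by
      rw [hq', dist_lineMap_left, Real.norm_of_nonneg hs0, dist_comm q p]
      calc s * dist p q ≤ s * ((k + 1) / 16) := by gcongr
        _ = 1 / 16 := by rw [hs]; field_simp
    have hdp : dist p q' ≤ k / 16 := by
      rw [hq', dist_comm, dist_lineMap_right, Real.norm_of_nonneg (by linarith), dist_comm q p]
      calc (1 - s) * dist p q ≤ (1 - s) * ((k + 1) / 16) := by gcongr
        _ = k / 16 := by rw [hs]; field_simp; ring
    calc _ ≤ chainConst N a * ∫⁻ x in ball q' (1 / 16), ENNReal.ofReal (u x) :=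
          h.lintegral_ball_le_chainConst_mul ha hdq (hSΩ q' hq'S)
      _ ≤ chainConst N a * (chainConst N a ^ k *
            ∫⁻ x in ball p (1 / 16), ENNReal.ofReal (u x)) := by
          gcongr; exact ih q' hq'S hdp
      _ = _ := by ring

/-- Interior weak Harnack inequality: the integral of a nonnegative supersolution over the core
cube is controlled by its value at any point of the core cube. -/
lemma exists_lintegral_coreCube_le {a : ℝ} (ha : 0 ≤ a) (n : Fin N) :
    ∃ C : ENNReal, C ≠ ⊤ ∧ ∀ u : E → ℝ,
      IsNonnegSupersolution a u (cube 4 (EuclideanSpace.single n 2)) → ∀ z ∈ coreCube n,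
        ∫⁻ x in coreCube n, ENNReal.ofReal (u x) ≤ C * ENNReal.ofReal (u z) := by
  have hcomp := isCompact_coreCube n
  obtain ⟨t, htS, htfin, hcover⟩ := hcomp.finite_cover_balls (e := 1 / 16) (by norm_num)
  obtain ⟨k, hk⟩ := exists_nat_ge (16 * diam (coreCube n))
  refine ⟨htfin.toFinset.card * (chainConst N a ^ k * ((ENNReal.ofReal (1 / 16))⁻¹ *
    ENNReal.ofReal (meanValueConst N a))), ?_, ?_⟩
  · refine ENNReal.mul_ne_top (ENNReal.natCast_ne_top _) (ENNReal.mul_ne_top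
      (ENNReal.pow_ne_top (chainConst_ne_top a)) (ENNReal.mul_ne_top ?_ ENNReal.ofReal_ne_top))
    simp
  intro u hu z hz
  have hz1 : ∫⁻ x in ball z (1 / 16), ENNReal.ofReal (u x)
      ≤ (ENNReal.ofReal (1 / 16))⁻¹ * ENNReal.ofReal (meanValueConst N a) *
        ENNReal.ofReal (u z) := by
    have h1 := hu.lintegral_ball_le ha (x₀ := z) (ρ := 1 / 16) (R := 2 / 16) (R' := 3 / 16)
      (by norm_num) (by norm_num) (by norm_num) (by norm_num)
      ((ball_subset_ball (by norm_num)).trans (ball_subset_of_mem_coreCube hz))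
    rw [ENNReal.ofReal_mul (meanValueConst_nonneg a)] at h1
    norm_num only at h1
    rw [mul_assoc, mul_comm (_⁻¹), ← div_eq_mul_inv, ENNReal.le_div_iff_mul_le (by simp) (by simp),
      mul_comm]
    exact h1
  calc ∫⁻ x in coreCube n, ENNReal.ofReal (u x)
      ≤ ∫⁻ x in ⋃ q ∈ htfin.toFinset, ball q (1 / 16), ENNReal.ofReal (u x) :=
        lintegral_mono_set (by simpa using hcover)
    _ ≤ ∑ q ∈ htfin.toFinset, ∫⁻ x in ball q (1 / 16), ENNReal.ofReal (u x) := by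
        have h2 := measure_biUnion_finset_le (μ := volume.withDensity fun x => ENNReal.ofReal (u x))
          htfin.toFinset fun q : E => ball q (1 / 16)
        rw [withDensity_apply _
          (Finset.measurableSet_biUnion _ fun _ _ => measurableSet_ball)] at h2
        simpa only [withDensity_apply _ measurableSet_ball] using h2
    _ ≤ ∑ q ∈ htfin.toFinset, chainConst N a ^ k * ((ENNReal.ofReal (1 / 16))⁻¹ *
          ENNReal.ofReal (meanValueConst N a) * ENNReal.ofReal (u z)) := by
        refine Finset.sum_le_sum fun q hq => ?_
        have hqS : q ∈ coreCube n := htS (by simpa using hq)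
        refine (hu.lintegral_ball_le_pow_mul ha (convex_coreCube n)
          (fun _ hp => ball_subset_of_mem_coreCube hp) hz k q hqS ?_).trans (by gcongr)
        have := dist_le_diam_of_mem hcomp.isBounded hz hqS
        linarith
    _ = _ := by
        rw [Finset.sum_const, nsmul_eq_mul]
        ring

end Chain

section BoundaryEstimate

variable {N : ℕ}

local notation "E" => EuclideanSpace ℝ (Fin N)

lemma height_mem_of_mem_cube_one {n : Fin N} {x : E}
    (hx : x ∈ cube 1 (EuclideanSpace.single n (1 / 2))) : x n ∈ Ioo (0 : ℝ) 1 := by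
  have := hx n
  simp only [PiLp.single_apply, if_true, abs_lt] at this
  constructor <;> linarith [this.1, this.2]

lemma abs_lt_of_mem_cube_one {n i : Fin N} (hi : i ≠ n) {x : E}
    (hx : x ∈ cube 1 (EuclideanSpace.single n (1 / 2))) : |x i| < 1 / 2 := by
  have := hx i
  simpa only [PiLp.single_apply, if_neg hi, sub_zero] using this

/-- Hopf lemma: if `u / x_n` is at most `2` somewhere on the unit cube at the boundary, then `u` is
bounded by a universal constant somewhere in the core cube. -/
lemma IsNonnegSupersolution.exists_mem_coreCube_le {a : ℝ} (ha : 0 ≤ a) {n : Fin N} {u : E → ℝ}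
    (hu : IsNonnegSupersolution a u (cube 4 (EuclideanSpace.single n 2))) {x : E}
    (hx : x ∈ cube 1 (EuclideanSpace.single n (1 / 2))) (hux : u x ≤ 2 * x n) :
    ∃ z ∈ coreCube n, u z ≤ 8 * Real.exp (2 * N + a + 1) := by
  obtain ⟨hx0, hx1⟩ := height_mem_of_mem_cube_one hx
  set z : E := x + (1 - x n) • EuclideanSpace.single n (1 : ℝ) with hz
  have hzn : z n = 1 := by simp [hz]
  have hzi : ∀ i ≠ n, z i = x i := fun i hi => by simp [hz, hi]
  have hsub : closedBall z (1 / 2) ⊆ coreCube n := by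
    intro y hy i
    have h1 : |y i - z i| ≤ 1 / 2 := by
      have := PiLp.norm_apply_le (y - z) i
      rw [mem_closedBall, dist_eq_norm] at hy
      simpa using this.trans hy
    rcases eq_or_ne i n with rfl | hi
    · rw [hzn] at h1
      simp only [PiLp.single_apply, if_true, abs_le] at *
      constructor <;> linarith [h1.1, h1.2]
    · have h2 := abs_lt_of_mem_cube_one hi hx
      rw [hzi i hi] at h1
      simp only [PiLp.single_apply, if_neg hi, sub_zero]
      have := abs_sub_abs_le_abs_sub (y i) (x i)
      linarith
  have hball : ball z 1 ⊆ cube 4 (EuclideanSpace.single n 2) := by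
    refine ball_subset_cube (s := 1) (fun i => ?_) (by norm_num)
    rcases eq_or_ne i n with rfl | hi
    · rw [hzn]
      simp only [PiLp.single_apply, if_true]
      norm_num
    · rw [hzi i hi]
      simp only [PiLp.single_apply, if_neg hi, sub_zero]
      linarith [abs_lt_of_mem_cube_one hi hx]
  obtain ⟨p, hp, hpmin⟩ := (isCompact_closedBall z (1 / 2)).exists_isMinOn
    (nonempty_closedBall.2 (by norm_num)) (hu.contDiffOn.continuousOn.mono
      ((closedBall_subset_ball (by norm_num)).trans hball))
  refine ⟨p, hsub hp, ?_⟩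
  have hE := Real.exp_pos (2 * N + a + 1)
  rcases le_or_gt (u p) 0 with hp0 | hp0
  · linarith
  set K : ℝ := 2 * N + a + 1 with hK
  have hK1 : 1 ≤ K := by have : (0 : ℝ) ≤ N := N.cast_nonneg; linarith
  have hxz : ‖x - z‖ = 1 - x n := by
    simp [hz, norm_smul, abs_of_pos (sub_pos.2 hx1)]
  have hbar := hu.barrier_le ha (z := z) (ρ := 1 - x n / 2) hp0 (by linarith)
    ((closedBall_subset_ball (by linarith)).trans hball) (fun y hy => hpmin hy) (x := x)
    (by rw [mem_closedBall, dist_eq_norm, hxz]; linarith)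
  rw [← hK, hxz] at hbar
  have hexp : Real.exp (-K) * (x n / 4) ≤
      Real.exp (-K * (1 - x n) ^ 2) - Real.exp (-K * (1 - x n / 2) ^ 2) := by
    set s := -K * (1 - x n / 2) ^ 2 with hs
    set t := -K * (1 - x n) ^ 2 with ht
    have hst : x n / 4 ≤ t - s := by
      have h1 : t - s = K * (x n / 2 * (2 - 3 * x n / 2)) := by rw [hs, ht]; ring
      have h2 : x n / 4 ≤ x n / 2 * (2 - 3 * x n / 2) := by nlinarith
      rw [h1]
      nlinarith
    have h1 : Real.exp t = Real.exp s * Real.exp (t - s) := by rw [← Real.exp_add]; ring_nf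
    have h2 := Real.add_one_le_exp (t - s)
    have h3 : Real.exp (-K) ≤ Real.exp s := by
      refine Real.exp_le_exp.2 ?_
      have : (1 - x n / 2) ^ 2 ≤ 1 := by nlinarith
      nlinarith
    calc Real.exp (-K) * (x n / 4) ≤ Real.exp s * (t - s) := by gcongr
      _ ≤ Real.exp s * (Real.exp (t - s) - 1) :=
        mul_le_mul_of_nonneg_left (by linarith) (Real.exp_pos s).le
      _ = Real.exp t - Real.exp s := by rw [h1]; ring
  have h1 : u p * (Real.exp (-K) * (x n / 4)) ≤ 2 * x n :=
    ((mul_le_mul_of_nonneg_left hexp hp0.le).trans hbar).trans hux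
  have h2 : u p * Real.exp (-K) ≤ 8 := by
    by_contra! h
    nlinarith
  have h3 : Real.exp (-K) * Real.exp K = 1 := by rw [← Real.exp_add]; simp
  calc u p = u p * Real.exp (-K) * Real.exp K := by rw [mul_assoc, h3, mul_one]
    _ ≤ 8 * Real.exp K := by gcongr

lemma isOpen_superlevel {n : Fin N} {u : E → ℝ}
    (hu : ContinuousOn u (cube 4 (EuclideanSpace.single n 2))) (t δ : ℝ) :
    IsOpen {x ∈ cube 4 (EuclideanSpace.single n 2) | δ < x n ∧ t * x n < u x} := by
  have h1 : IsOpen {x ∈ cube 4 (EuclideanSpace.single n 2) | t * x n < u x} := by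
    have := (hu.sub (by fun_prop : ContinuousOn (fun x : E => t * x n) _)).isOpen_inter_preimage
      (isOpen_cube 4 _) (isOpen_Ioi (a := (0 : ℝ)))
    convert this using 1
    ext x
    simp
  have h2 : IsOpen {x : E | δ < x n} := isOpen_lt continuous_const (by fun_prop)
  convert h1.inter h2 using 1
  ext x
  simp
  tauto

lemma cube_one_subset_cube_four (n : Fin N) :
    cube 1 (EuclideanSpace.single n (1 / 2) : E) ⊆ cube 4 (EuclideanSpace.single n 2) := by
  intro x hx i
  rcases eq_or_ne i n with rfl | hi
  · obtain ⟨h0, h1⟩ := height_mem_of_mem_cube_one hx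
    simp only [PiLp.single_apply, if_true, abs_lt]
    constructor <;> linarith
  · have := abs_lt_of_mem_cube_one hi hx
    simp only [PiLp.single_apply, if_neg hi, sub_zero]
    linarith

/-- Weak-type estimate away from the flat boundary, with polynomial loss in the distance. -/
lemma exists_mul_measure_superlevel_le {a : ℝ} (ha : 0 ≤ a) (n : Fin N) :
    ∃ C : ENNReal, C ≠ ⊤ ∧ ∀ u : E → ℝ,
      IsNonnegSupersolution a u (cube 4 (EuclideanSpace.single n 2)) →
      (∃ x ∈ cube 1 (EuclideanSpace.single n (1 / 2)), u x ≤ 2 * x n) →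
      ∀ t δ : ℝ, 0 < t → 0 < δ → δ ≤ 1 →
        ENNReal.ofReal (t * δ ^ (N + 2)) *
          volume {x ∈ cube 1 (EuclideanSpace.single n (1 / 2)) | δ < x n ∧ t * x n < u x} ≤ C := by
  obtain ⟨C₁, hC₁, hcore⟩ := exists_lintegral_coreCube_le ha n
  set V : ENNReal := volume (ball (0 : E) 1) with hV
  have hV0 : V ≠ 0 := (measure_ball_pos volume _ one_pos).ne'
  have hVtop : V ≠ ⊤ := measure_ball_lt_top.ne
  set D : ENNReal := ENNReal.ofReal (meanValueConst N a) *
    (C₁ * ENNReal.ofReal (8 * Real.exp (2 * N + a + 1))) with hD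
  have hDtop : D ≠ ⊤ := ENNReal.mul_ne_top ENNReal.ofReal_ne_top
    (ENNReal.mul_ne_top hC₁ ENNReal.ofReal_ne_top)
  have h8 : ENNReal.ofReal ((1 / 8) ^ (N + 1)) ≠ 0 := by
    rw [Ne, ENNReal.ofReal_eq_zero, not_le]; positivity
  refine ⟨D / (ENNReal.ofReal ((1 / 8) ^ (N + 1)) * V),
    ENNReal.div_ne_top hDtop (mul_ne_zero h8 hV0), ?_⟩
  rintro u hu ⟨x₁, hx₁, hux₁⟩ t δ ht hδ hδ1
  obtain ⟨z, hz, huz⟩ := hu.exists_mem_coreCube_le ha hx₁ hux₁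
  set A := {x ∈ cube 1 (EuclideanSpace.single n (1 / 2)) | δ < x n ∧ t * x n < u x} with hA
  set ε : ℝ := δ / 8 with hε
  have hε0 : 0 < ε := by positivity
  set e : E := EuclideanSpace.single n 1 with he
  have hAopen : IsOpen A := by
    have h1 := (isOpen_cube 1 (EuclideanSpace.single n (1 / 2) : E)).inter
      (isOpen_superlevel hu.contDiffOn.continuousOn t δ)
    convert h1 using 1
    ext x
    have := @cube_one_subset_cube_four N n x
    simp only [hA, mem_ofPred_eq, mem_inter_iff]
    tauto
  set S : Set (E × E) := {q | q.1 ∈ A ∧ dist q.2 (q.1 + e) < ε} with hS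
  have hSopen : IsOpen S := by
    have h1 : IsOpen {q : E × E | dist q.2 (q.1 + e) < ε} :=
      isOpen_lt (by fun_prop) continuous_const
    exact (hAopen.preimage continuous_fst).inter h1
  have hshift : ∀ x ∈ A, ∀ p, dist p (x + e) < ε → p ∈ coreCube n ∧
      ball p (1 + 3 * ε) ⊆ cube 4 (EuclideanSpace.single n 2) ∧ dist x p < 1 + ε := by
    rintro x ⟨hxQ, hxδ, -⟩ p hp
    have hcoord : ∀ i, |p i - (x i + e i)| < ε := fun i => by
      have := PiLp.norm_apply_le (p - (x + e)) i
      rw [dist_eq_norm] at hp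
      simpa using this.trans_lt hp
    obtain ⟨-, hx1⟩ := height_mem_of_mem_cube_one hxQ
    have hn : |p n - (x n + 1)| < ε := by simpa [he] using hcoord n
    have hi : ∀ i ≠ n, |p i| < 1 / 2 + ε := fun i hin => by
      have h1 : |p i - x i| < ε := by simpa [he, hin] using hcoord i
      have h2 := abs_lt_of_mem_cube_one hin hxQ
      have := abs_sub_abs_le_abs_sub (p i) (x i)
      linarith
    rw [abs_lt] at hn
    refine ⟨fun i => ?_, ?_, ?_⟩
    · rcases eq_or_ne i n with rfl | hin
      · simp only [PiLp.single_apply, if_true, abs_le]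
        constructor <;> linarith [hn.1, hn.2]
      · simp only [PiLp.single_apply, if_neg hin, sub_zero]
        linarith [hi i hin]
    · refine ball_subset_cube (s := 1 - 3 * ε) (fun i => ?_) (by linarith)
      rcases eq_or_ne i n with rfl | hin
      · simp only [PiLp.single_apply, if_true, abs_le]
        constructor <;> linarith [hn.1, hn.2]
      · simp only [PiLp.single_apply, if_neg hin, sub_zero]
        linarith [hi i hin]
    · have h1 : dist x (x + e) = 1 := by simp [he]
      have := dist_triangle_right x p (x + e)
      linarith
  have hslice : ∀ p, ENNReal.ofReal (ε * (t * δ)) * volume ((fun x => (x, p)) ⁻¹' S)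
      ≤ (coreCube n).indicator
        (fun p => ENNReal.ofReal (meanValueConst N a) * ENNReal.ofReal (u p)) p := by
    intro p
    rcases ((fun x => (x, p)) ⁻¹' S).eq_empty_or_nonempty with hemp | ⟨x₀, hx₀A, hx₀p⟩
    · simp [hemp]
    obtain ⟨hpcore, hpball, -⟩ := hshift x₀ hx₀A p hx₀p
    rw [indicator_of_mem hpcore, ENNReal.ofReal_mul hε0.le, mul_assoc,
      ← ENNReal.ofReal_mul (meanValueConst_nonneg a)]
    have h1 := hu.lintegral_ball_le ha (x₀ := p) (ρ := 1 + ε) (R := 1 + 2 * ε)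
      (by linarith) (by linarith) (by linarith) (by linarith) hpball
    refine le_trans ?_ h1
    rw [show 1 + 2 * ε - (1 + ε) = ε by ring]
    gcongr
    rw [← setLIntegral_const]
    have hmeas : MeasurableSet ((fun x => (x, p)) ⁻¹' S) :=
      (hSopen.preimage (by fun_prop)).measurableSet
    refine (setLIntegral_mono' hmeas ?_).trans (lintegral_mono_set ?_)
    · rintro x ⟨⟨-, hxδ, hxu⟩, -⟩
      refine ENNReal.ofReal_le_ofReal ?_
      simp only at hxδ hxu
      nlinarith
    · rintro x ⟨hxA, hxp⟩
      exact (hshift x hxA p hxp).2.2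
  have hprod1 : (volume.prod volume) S = volume A * (ENNReal.ofReal (ε ^ N) * V) := by
    rw [Measure.prod_apply hSopen.measurableSet]
    have h1 : ∀ x, volume (Prod.mk x ⁻¹' S)
        = A.indicator (fun _ => ENNReal.ofReal (ε ^ N) * V) x := by
      intro x
      by_cases hx : x ∈ A
      · have h2 : Prod.mk x ⁻¹' S = ball (x + e) ε := by
          ext p; simp [hS, hx]
        rw [indicator_of_mem hx, h2, Measure.addHaar_ball_of_pos _ _ hε0,
          finrank_euclideanSpace_fin]
      · have h2 : Prod.mk x ⁻¹' S = ∅ := by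
          ext p; simp [hS, hx]
        rw [indicator_of_notMem hx, h2, measure_empty]
    simp only [h1]
    rw [lintegral_indicator hAopen.measurableSet, setLIntegral_const, mul_comm]
  have hprod2 : ENNReal.ofReal (ε * (t * δ)) * (volume.prod volume) S ≤ D := by
    rw [Measure.prod_apply_symm hSopen.measurableSet,
      ← lintegral_const_mul' _ _ ENNReal.ofReal_ne_top]
    refine (lintegral_mono hslice).trans ?_
    rw [lintegral_indicator (isCompact_coreCube n).measurableSet,
      lintegral_const_mul' _ _ ENNReal.ofReal_ne_top, hD]
    gcongr
    exact (hcore u hu z hz).trans (by gcongr)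
  rw [ENNReal.le_div_iff_mul_le (Or.inl (mul_ne_zero h8 hV0))
    (Or.inl (ENNReal.mul_ne_top ENNReal.ofReal_ne_top hVtop))]
  rw [hprod1] at hprod2
  refine le_trans (le_of_eq ?_) hprod2
  have h3 : ENNReal.ofReal (t * δ ^ (N + 2)) * ENNReal.ofReal ((1 / 8) ^ (N + 1))
      = ENNReal.ofReal (ε * (t * δ)) * ENNReal.ofReal (ε ^ N) := by
    rw [← ENNReal.ofReal_mul (by positivity), ← ENNReal.ofReal_mul (by positivity)]
    congr 1
    rw [hε]
    field_simp
    ring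
  calc _ = (ENNReal.ofReal (t * δ ^ (N + 2)) * ENNReal.ofReal ((1 / 8) ^ (N + 1))) *
        (volume A * V) := by ring
    _ = _ := by rw [h3]; ring

lemma volume_slab_le (n : Fin N) {δ : ℝ} :
    volume {x ∈ cube 1 (EuclideanSpace.single n (1 / 2) : E) | x n ≤ δ} ≤ ENNReal.ofReal δ := by
  set B : Fin N → Set ℝ := fun i => if i = n then Icc 0 δ else Ioo (-(1 / 2)) (1 / 2) with hB
  have hsub : {x ∈ cube 1 (EuclideanSpace.single n (1 / 2) : E) | x n ≤ δ}
      ⊆ (WithLp.ofLp : E → Fin N → ℝ) ⁻¹' (univ.pi B) := by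
    rintro x ⟨hx, hxδ⟩ i -
    rcases eq_or_ne i n with rfl | hi
    · simpa [hB] using ⟨(height_mem_of_mem_cube_one hx).1.le, hxδ⟩
    · simpa [hB, hi, abs_lt] using abs_lt_of_mem_cube_one hi hx
  refine (measure_mono hsub).trans ?_
  have hmeas : MeasurableSet (univ.pi B) := by
    refine MeasurableSet.univ_pi fun i => ?_
    by_cases hi : i = n
    · simp [hB, hi]
    · simp [hB, hi]
  rw [(PiLp.volume_preserving_ofLp (Fin N)).measure_preimage hmeas.nullMeasurableSet, volume_pi_pi,
    Finset.prod_eq_single n]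
  · simp [hB]
  · intro i _ hi
    simp [hB, hi]
    norm_num
  · simp

end BoundaryEstimate

/-- Geometric decay of superlevel sets, from a polynomially weighted weak-type bound and the
measure of thin slabs. -/
lemma exists_measure_superlevel_lt {N : ℕ} {a : ℝ} (ha : 0 ≤ a) (n : Fin N) :
    ∃ L : ℝ, 1 < L ∧ ∀ u : EuclideanSpace ℝ (Fin N) → ℝ,
      IsNonnegSupersolution a u (cube 4 (EuclideanSpace.single n 2)) →
      (∃ x ∈ cube 1 (EuclideanSpace.single n (1 / 2)), u x ≤ 2 * x n) →
      ∀ j : ℕ, 1 ≤ j →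
        volume {x ∈ cube 1 (EuclideanSpace.single n (1 / 2)) | (L ^ (N + 3)) ^ j < u x / x n}
          < ENNReal.ofReal ((1 / 2) ^ j) := by
  obtain ⟨C, hC, hbound⟩ := exists_mul_measure_superlevel_le ha n
  set c := C.toReal with hc
  have hc0 : 0 ≤ c := ENNReal.toReal_nonneg
  set L : ℝ := 2 * (2 + c) with hL
  have hL1 : 1 < L := by linarith
  refine ⟨L, hL1, fun u hu hx j hj => ?_⟩
  have hLj : 0 < L ^ j := by positivity
  have hLj1 : 1 ≤ L ^ j := one_le_pow₀ hL1.le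
  set δ : ℝ := (L ^ j)⁻¹ with hδ
  have hδ0 : 0 < δ := by positivity
  have hδ1 : δ ≤ 1 := inv_le_one_of_one_le₀ hLj1
  set t : ℝ := (L ^ (N + 3)) ^ j with ht
  have ht0 : 0 < t := by positivity
  have htδ : t * δ ^ (N + 2) = L ^ j := by
    have h1 : t = L ^ j * (L ^ j) ^ (N + 2) := by rw [ht]; ring_nf
    rw [h1, mul_assoc, ← mul_pow, hδ, mul_inv_cancel₀ hLj.ne', one_pow, mul_one]
  have hupper := hbound u hu hx t δ ht0 hδ0 hδ1
  rw [htδ, mul_comm, ← ENNReal.le_div_iff_mul_le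
    (Or.inl (by rw [Ne, ENNReal.ofReal_eq_zero, not_le]; exact hLj))
    (Or.inl ENNReal.ofReal_ne_top), ← ENNReal.ofReal_toReal hC, ← hc,
    ← ENNReal.ofReal_div_of_pos hLj] at hupper
  have hsub : {x ∈ cube 1 (EuclideanSpace.single n (1 / 2)) | t < u x / x n} ⊆
      {x ∈ cube 1 (EuclideanSpace.single n (1 / 2)) | x n ≤ δ} ∪
      {x ∈ cube 1 (EuclideanSpace.single n (1 / 2)) | δ < x n ∧ t * x n < u x} := by
    rintro x ⟨hxQ, hxt⟩
    rcases le_or_gt (x n) δ with h | h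
    · exact Or.inl ⟨hxQ, h⟩
    · exact Or.inr ⟨hxQ, h, (lt_div_iff₀ (hδ0.trans h)).1 hxt⟩
  calc _ ≤ _ := (measure_mono hsub).trans (measure_union_le _ _)
    _ ≤ ENNReal.ofReal δ + ENNReal.ofReal (c / L ^ j) := add_le_add (volume_slab_le n) hupper
    _ = ENNReal.ofReal ((1 + c) / L ^ j) := by
      rw [← ENNReal.ofReal_add hδ0.le (by positivity), hδ, inv_eq_one_div, add_div]
    _ < ENNReal.ofReal ((1 / 2) ^ j) := by
      refine (ENNReal.ofReal_lt_ofReal_iff (by positivity)).2 ?_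
      have h1 : 2 + c ≤ (2 + c) ^ j := le_self_pow₀ (by linarith) (by omega)
      rw [div_lt_iff₀ hLj, ← mul_pow, hL, ← mul_assoc]
      norm_num
      linarith

/-- Iteration lemma (Lemma 3.6 for `p = 2`): here `Q_ρ := Q_ρ(ρe)` with
`e = (0,…,0,1/2)`. If `inf_{Q₁} u/x_N ≤ 1` then the superlevel sets of `u/x_N`
at heights `M^j` decay geometrically in measure. -/
theorem stmt_8 {N : ℕ} (hN : 2 ≤ N) (a : ℝ) (ha : 0 ≤ a) :
    ∃ M μ : ℝ, 1 < M ∧ μ ∈ Ioo (0 : ℝ) 1 ∧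
      ∀ u : EuclideanSpace ℝ (Fin N) → ℝ,
        ContDiffOn ℝ 2 u (cube 4 (EuclideanSpace.single (⟨N - 1, by omega⟩ : Fin N) 2)) →
        (∀ x ∈ cube 4 (EuclideanSpace.single (⟨N - 1, by omega⟩ : Fin N) 2), 0 ≤ u x) →
        (∀ x ∈ cube 4 (EuclideanSpace.single (⟨N - 1, by omega⟩ : Fin N) 2),
          0 ≤ -lap u x + a * u x) →
        sInf ((fun x => u x / x (⟨N - 1, by omega⟩ : Fin N)) ''
          cube 1 (EuclideanSpace.single (⟨N - 1, by omega⟩ : Fin N) (1 / 2))) ≤ 1 →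
        ∀ j : ℕ, 1 ≤ j →
          volume {x ∈ cube 1 (EuclideanSpace.single (⟨N - 1, by omega⟩ : Fin N) (1 / 2)) |
              M ^ j < u x / x ⟨N - 1, by omega⟩}
            < ENNReal.ofReal ((1 - μ) ^ j) := by
  obtain ⟨L, hL, hdecay⟩ := exists_measure_superlevel_lt ha (⟨N - 1, by omega⟩ : Fin N)
  refine ⟨L ^ (N + 3), 1 / 2, one_lt_pow₀ hL (by omega), by norm_num, ?_⟩
  intro u hu hnonneg hlap hinf j hj
  rw [show (1 - 1 / 2 : ℝ) = 1 / 2 by norm_num]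
  refine hdecay u ⟨isOpen_cube 4 _, hu, hnonneg, fun x hx => by linarith [hlap x hx]⟩ ?_ j hj
  obtain ⟨_, ⟨x, hx, rfl⟩, hlt⟩ := exists_lt_of_csInf_lt
    (Set.Nonempty.image _ ⟨EuclideanSpace.single ⟨N - 1, by omega⟩ (1 / 2), fun i => by simp⟩)
    (hinf.trans_lt one_lt_two)
  exact ⟨x, hx, ((div_lt_iff₀ (height_mem_of_mem_cube_one hx).1).1 hlt).le⟩
end

section
/- Let N ≥ 2, let ω = B₁(0) ⊂ ℝ^N be the open unit ball, let K ≥ 0 and p > N. There exist R̄ > 0, ε > 0, C₁ > 0 and C₂ > 0, depending only on N, K and p, with the following property: for every continuous a : ω → ℝ with 0 ≤ a ≤ K, every continuous b : ω → ℝ whose negative part b⁻ = max(−b,0) belongs to L^p(ω), every C² function u : ω → ℝ with u ≥ 0 on ω and −Δu(x) + a(x)u(x) ≥ b(x) for all x ∈ ω, every x₀ ∈ ∂ω and every R ∈ (0, R̄], one has inf_{x ∈ B_R(x₀) ∩ ω} u(x)/(1−|x|) ≥ C₁·( ∫_{B_R(x₀) ∩ ω} ( u(x)/(1−|x|) )^ε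 dx )^{1/ε} − C₂·‖b⁻‖_{L^p(ω)}. -/
open MeasureTheory Metric Set

/-- The radial profile `τ ^ (-n) * exp (-l √τ)`. -/
noncomputable def profile (n l τ : ℝ) : ℝ := τ ^ (-n) * Real.exp (-l * √τ)

/-- Minus the derivative of `profile`. -/
noncomputable def profileSlope (n l τ : ℝ) : ℝ :=
  (n * τ ^ (-n - 1) + l / 2 * τ ^ (-n - 1 / 2)) * Real.exp (-l * √τ)

/-- The excess `τ * profileSlope - n * profile`. -/
noncomputable def profileExcess (n l τ : ℝ) : ℝ :=
  l / 2 * τ ^ (1 / 2 - n) * Real.exp (-l * √τ)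

lemma profile_pos {n l τ : ℝ} (hτ : 0 < τ) : 0 < profile n l τ := by
  unfold profile; positivity

lemma hasDerivAt_exp_neg_mul_sqrt (l : ℝ) {τ : ℝ} (hτ : 0 < τ) :
    HasDerivAt (fun t => Real.exp (-l * √t))
      (-(l / 2 * τ ^ (-(1 / 2) : ℝ)) * Real.exp (-l * √τ)) τ := by
  have h := ((Real.hasDerivAt_sqrt hτ.ne').const_mul (-l)).exp
  convert h using 1
  rw [Real.rpow_neg hτ.le, ← Real.sqrt_eq_rpow]
  field_simp

lemma hasDerivAt_profile (n l : ℝ) {τ : ℝ} (hτ : 0 < τ) :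
    HasDerivAt (profile n l) (-profileSlope n l τ) τ := by
  have h := (Real.hasDerivAt_rpow_const (p := -n) (Or.inl hτ.ne')).mul
    (hasDerivAt_exp_neg_mul_sqrt l hτ)
  have e : τ ^ (-n - 1 / 2) = τ ^ (-n) * τ ^ (-(1 / 2) : ℝ) := by
    rw [← Real.rpow_add hτ]; ring_nf
  refine h.congr_deriv ?_
  rw [profileSlope, e]; ring

lemma profileExcess_eq (n l : ℝ) {τ : ℝ} (hτ : 0 < τ) :
    τ * profileSlope n l τ - n * profile n l τ = profileExcess n l τ := by
  have e1 : τ ^ (-n) = τ * τ ^ (-n - 1) := by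
    nth_rw 2 [← Real.rpow_one τ]
    rw [← Real.rpow_add hτ]; ring_nf
  have e2 : τ ^ (1 / 2 - n) = τ * τ ^ (-n - 1 / 2) := by
    nth_rw 2 [← Real.rpow_one τ]
    rw [← Real.rpow_add hτ]; ring_nf
  rw [profileSlope, profile, profileExcess, e1, e2]; ring

lemma profileSlope_nonneg {n l τ : ℝ} (hn : 0 ≤ n) (hl : 0 ≤ l) (hτ : 0 < τ) :
    0 ≤ profileSlope n l τ := by
  unfold profileSlope; positivity

lemma profileSlope_le {n l τ : ℝ} (hn : 0 ≤ n) (hl : 0 ≤ l) (hτ : 0 < τ) :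
    profileSlope n l τ ≤ (n + 1) * τ ^ (-n - 1) := by
  have e2 : τ ^ (-n - 1 / 2) = √τ * τ ^ (-n - 1) := by
    rw [Real.sqrt_eq_rpow, ← Real.rpow_add hτ]; ring_nf
  have h1 : l * √τ * Real.exp (-l * √τ) ≤ 1 := by
    have h0 : 0 ≤ l * √τ := by positivity
    have h2 := Real.add_one_le_exp (l * √τ)
    rw [neg_mul, Real.exp_neg, ← div_eq_mul_inv, div_le_one (Real.exp_pos _)]
    linarith
  have h2 : Real.exp (-l * √τ) ≤ 1 := by
    rw [Real.exp_le_one_iff]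
    have : 0 ≤ l * √τ := by positivity
    linarith
  have h3 : 0 < τ ^ (-n - 1) := by positivity
  rw [profileSlope, e2]
  calc _ = (n * Real.exp (-l * √τ) + 1 / 2 * (l * √τ * Real.exp (-l * √τ))) * τ ^ (-n - 1) := by
        ring
    _ ≤ (n * 1 + 1 / 2 * 1) * τ ^ (-n - 1) := by gcongr
    _ ≤ _ := by gcongr ?_ * _; linarith

lemma profileExcess_antitoneOn {n l : ℝ} (hn : 1 / 2 ≤ n) (hl : 0 ≤ l) :
    AntitoneOn (profileExcess n l) (Ioi 0) := by
  intro a ha b hb hab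
  have ha' : 0 < a := ha
  unfold profileExcess
  have h1 : b ^ (1 / 2 - n) ≤ a ^ (1 / 2 - n) :=
    Real.rpow_le_rpow_of_nonpos ha' hab (by linarith)
  have h2 : Real.exp (-l * √b) ≤ Real.exp (-l * √a) := by
    apply Real.exp_le_exp.2
    have := mul_le_mul_of_nonneg_left (Real.sqrt_le_sqrt hab) hl
    linarith
  gcongr

lemma profileExcess_pos {n l τ : ℝ} (hl : 0 < l) (hτ : 0 < τ) : 0 < profileExcess n l τ := by
  unfold profileExcess; positivity

lemma profile_antitoneOn {n l : ℝ} (hn : 0 ≤ n) (hl : 0 ≤ l) :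
    AntitoneOn (profile n l) (Ioi 0) := by
  intro a ha b hb hab
  have ha' : 0 < a := ha
  unfold profile
  have h1 : b ^ (-n) ≤ a ^ (-n) :=
    Real.rpow_le_rpow_of_nonpos ha' hab (by linarith)
  have h2 : Real.exp (-l * √b) ≤ Real.exp (-l * √a) := by
    apply Real.exp_le_exp.2
    have := mul_le_mul_of_nonneg_left (Real.sqrt_le_sqrt hab) hl
    linarith
  gcongr

/-- A decreasing primitive of `-profile` on the positive half-line. -/
noncomputable def profilePrim (n l τ : ℝ) : ℝ := -∫ t in (1 : ℝ)..τ, profile n l t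

lemma continuousOn_profile (n l : ℝ) : ContinuousOn (profile n l) (Ioi 0) :=
  fun _ hx => (hasDerivAt_profile n l hx).continuousAt.continuousWithinAt

lemma intervalIntegrable_profile (n l : ℝ) {a b : ℝ} (ha : 0 < a) (hb : 0 < b) :
    IntervalIntegrable (profile n l) volume a b := by
  apply ContinuousOn.intervalIntegrable
  apply (continuousOn_profile n l).mono
  intro x hx
  exact lt_of_lt_of_le (lt_min ha hb) hx.1

lemma hasDerivAt_profilePrim (n l : ℝ) {τ : ℝ} (hτ : 0 < τ) :
    HasDerivAt (profilePrim n l) (-profile n l τ) τ := by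
  apply HasDerivAt.fun_neg
  apply intervalIntegral.integral_hasDerivAt_right (intervalIntegrable_profile n l one_pos hτ)
  · exact (continuousOn_profile n l).stronglyMeasurableAtFilter isOpen_Ioi τ hτ
  · exact (hasDerivAt_profile n l hτ).continuousAt

lemma profilePrim_sub (n l : ℝ) {a b : ℝ} (ha : 0 < a) (hb : 0 < b) :
    profilePrim n l a - profilePrim n l b = ∫ t in a..b, profile n l t := by
  rw [← intervalIntegral.integral_add_adjacent_intervals
    (intervalIntegrable_profile n l ha one_pos) (intervalIntegrable_profile n l one_pos hb),
    intervalIntegral.integral_symm 1 a]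
  unfold profilePrim; ring

lemma profilePrim_sub_le {n l a b : ℝ} (hn : 1 / 2 ≤ n) (hl : 0 ≤ l) (ha : 0 < a) (hab : a ≤ b) :
    profilePrim n l a - profilePrim n l b ≤ 2 * a ^ (1 / 2 - n) * (√b - √a) := by
  have hb : 0 < b := ha.trans_le hab
  have key : MonotoneOn (fun τ => 2 * a ^ (1 / 2 - n) * √τ + profilePrim n l τ) (Ici a) := by
    apply monotoneOn_of_hasDerivWithinAt_nonneg
      (f' := fun τ => 2 * a ^ (1 / 2 - n) * (1 / (2 * √τ)) + -profile n l τ) (convex_Ici a)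
    · intro τ hτ
      have hτ0 : 0 < τ := ha.trans_le hτ
      exact (((Real.hasDerivAt_sqrt hτ0.ne').const_mul _).add
        (hasDerivAt_profilePrim n l hτ0)).continuousAt.continuousWithinAt
    · intro τ hτ
      rw [interior_Ici] at hτ
      have hτ0 : 0 < τ := ha.trans hτ
      exact (((Real.hasDerivAt_sqrt hτ0.ne').const_mul _).add
        (hasDerivAt_profilePrim n l hτ0)).hasDerivWithinAt
    · intro τ hτ
      rw [interior_Ici] at hτ
      have hτ0 : 0 < τ := ha.trans hτ
      have e : τ ^ (-n) = τ ^ (1 / 2 - n) * (1 / √τ) := by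
        rw [Real.sqrt_eq_rpow, one_div (τ ^ _), ← Real.rpow_neg hτ0.le, ← Real.rpow_add hτ0]; ring_nf
      have h1 : τ ^ (1 / 2 - n) ≤ a ^ (1 / 2 - n) :=
        Real.rpow_le_rpow_of_nonpos ha (le_of_lt hτ) (by linarith)
      have h2 : Real.exp (-l * √τ) ≤ 1 := by
        rw [Real.exp_le_one_iff]
        have : 0 ≤ l * √τ := by positivity
        linarith
      have h3 : profile n l τ ≤ a ^ (1 / 2 - n) * (1 / √τ) := by
        rw [profile, e]
        calc _ ≤ τ ^ (1 / 2 - n) * (1 / √τ) * 1 := by gcongr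
          _ ≤ _ := by rw [mul_one]; gcongr
      have h4 : 2 * a ^ (1 / 2 - n) * (1 / (2 * √τ)) = a ^ (1 / 2 - n) * (1 / √τ) := by
        field_simp
      rw [h4]; linarith
  have := key (mem_Ici.2 le_rfl) (mem_Ici.2 hab) hab
  simp only at this
  linarith

lemma le_profilePrim_sub {n l a b : ℝ} (hn : 0 ≤ n) (hl : 0 ≤ l) (ha : 0 < a) (hab : a ≤ b) :
    (b - a) * profile n l b ≤ profilePrim n l a - profilePrim n l b := by
  have hb : 0 < b := ha.trans_le hab
  rw [profilePrim_sub n l ha hb]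
  have := intervalIntegral.integral_mono_on hab
    (intervalIntegrable_const (c := profile n l b) (μ := volume))
    (intervalIntegrable_profile n l ha hb)
    (fun x hx => profile_antitoneOn hn hl (mem_Ioi.2 (ha.trans_le hx.1)) (mem_Ioi.2 hb) hx.2)
  simpa using this

lemma profilePrim_sub_le_mul {n l a b : ℝ} (hn : 0 ≤ n) (hl : 0 ≤ l) (ha : 0 < a) (hab : a ≤ b) :
    profilePrim n l a - profilePrim n l b ≤ (b - a) * profile n l a := by
  have hb : 0 < b := ha.trans_le hab
  rw [profilePrim_sub n l ha hb]
  have := intervalIntegral.integral_mono_on hab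
    (intervalIntegrable_profile n l ha hb)
    (intervalIntegrable_const (c := profile n l a) (μ := volume))
    (fun x hx => profile_antitoneOn hn hl (mem_Ioi.2 ha) (mem_Ioi.2 (ha.trans_le hx.1)) hx.1)
  simpa using this

lemma profilePrim_antitoneOn (n l : ℝ) : AntitoneOn (profilePrim n l) (Ioi 0) := by
  intro a ha b hb hab
  have ha' : 0 < a := ha
  have := intervalIntegral.integral_nonneg (μ := volume) hab
    (fun x hx => (profile_pos (n := n) (l := l) (ha'.trans_le hx.1)).le)
  rw [← profilePrim_sub n l ha' hb] at this
  linarith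

lemma mul_profilePrim_sub_le {n l K a b : ℝ} (hn : 1 / 2 ≤ n) (hl : 0 ≤ l) (hK : K ≤ l ^ 2)
    (ha : 0 < a) (hab : a ≤ b) :
    K * (profilePrim n l a - profilePrim n l b) ≤
      4 * (profileExcess n l a - profileExcess n l b) := by
  have hd : ∀ τ : ℝ, 0 < τ → HasDerivAt (fun τ => 4 * profileExcess n l τ - K * profilePrim n l τ)
      (4 * (l / 2 * (((1 / 2 - n) * τ ^ (1 / 2 - n - 1)) * Real.exp (-l * √τ) +
        τ ^ (1 / 2 - n) * (-(l / 2 * τ ^ (-(1 / 2) : ℝ)) * Real.exp (-l * √τ))))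
        - K * (-profile n l τ)) τ := by
    intro τ hτ
    refine HasDerivAt.sub (HasDerivAt.const_mul 4 ?_) ((hasDerivAt_profilePrim n l hτ).const_mul K)
    have h := ((Real.hasDerivAt_rpow_const (p := 1 / 2 - n) (Or.inl hτ.ne')).mul
      (hasDerivAt_exp_neg_mul_sqrt l hτ)).const_mul (l / 2)
    convert h using 1
    ext t; simp [profileExcess, mul_assoc]
  have key : AntitoneOn (fun τ => 4 * profileExcess n l τ - K * profilePrim n l τ) (Ici a) := by
    apply antitoneOn_of_hasDerivWithinAt_nonpos (convex_Ici a)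
    · intro τ hτ
      exact (hd τ (ha.trans_le hτ)).continuousAt.continuousWithinAt
    · intro τ hτ
      rw [interior_Ici] at hτ
      exact (hd τ (ha.trans hτ)).hasDerivWithinAt
    · intro τ hτ
      rw [interior_Ici] at hτ
      have hτ0 : 0 < τ := ha.trans hτ
      have e : τ ^ (-n) = τ ^ (1 / 2 - n) * τ ^ (-(1 / 2) : ℝ) := by
        rw [← Real.rpow_add hτ0]; ring_nf
      have h1 : 0 ≤ 2 * l * (n - 1 / 2) * τ ^ (1 / 2 - n - 1) * Real.exp (-l * √τ) := by
        have : 0 ≤ n - 1 / 2 := by linarith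
        positivity
      have h2 : K * profile n l τ ≤ l ^ 2 * profile n l τ :=
        mul_le_mul_of_nonneg_right hK (profile_pos hτ0).le
      have h3 : l ^ 2 * profile n l τ =
          l ^ 2 * (τ ^ (1 / 2 - n) * τ ^ (-(1 / 2) : ℝ)) * Real.exp (-l * √τ) := by
        rw [profile, e]; ring
      nlinarith
  have := key (mem_Ici.2 le_rfl) (mem_Ici.2 hab) hab
  simp only at this
  linarith

/-- A smooth convex function vanishing on `(-∞, η]` with slope `1` on `[2η, ∞)`. -/
noncomputable def cutPrim (η s : ℝ) : ℝ := ∫ t in (0 : ℝ)..s, Real.smoothTransition (t / η - 1)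

lemma continuous_cutSlope (η : ℝ) : Continuous fun t : ℝ => Real.smoothTransition (t / η - 1) :=
  Real.smoothTransition.continuous.comp (by fun_prop)

lemma hasDerivAt_cutPrim (η s : ℝ) :
    HasDerivAt (cutPrim η) (Real.smoothTransition (s / η - 1)) s :=
  intervalIntegral.integral_hasDerivAt_right ((continuous_cutSlope η).intervalIntegrable _ _)
    ((continuous_cutSlope η).stronglyMeasurableAtFilter _ _) (continuous_cutSlope η).continuousAt

lemma continuous_cutPrim (η : ℝ) : Continuous (cutPrim η) :=
  continuous_iff_continuousAt.2 fun s => (hasDerivAt_cutPrim η s).continuousAt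

lemma hasDerivAt_cutSlope (η s : ℝ) :
    HasDerivAt (fun t : ℝ => Real.smoothTransition (t / η - 1))
      (deriv Real.smoothTransition (s / η - 1) * (1 / η)) s := by
  have h1 : HasDerivAt (fun t : ℝ => t / η - 1) (1 / η) s :=
    ((hasDerivAt_id s).div_const η).sub_const 1
  have h2 : HasDerivAt Real.smoothTransition (deriv Real.smoothTransition (s / η - 1))
      (s / η - 1) :=
    ((Real.smoothTransition.contDiff (n := 1)).differentiable (by simp) _).hasDerivAt
  exact h2.comp s h1

lemma continuous_deriv_smoothTransition : Continuous (deriv Real.smoothTransition) :=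
  (Real.smoothTransition.contDiff (n := 1)).continuous_deriv (by simp)

lemma deriv_smoothTransition_nonneg (s : ℝ) : 0 ≤ deriv Real.smoothTransition s :=
  Real.smoothTransition.monotone.deriv_nonneg

lemma cutSlope_eq_zero {η s : ℝ} (hη : 0 < η) (hs : s ≤ η) :
    Real.smoothTransition (s / η - 1) = 0 :=
  Real.smoothTransition.zero_of_nonpos (by rw [sub_nonpos, div_le_one hη]; exact hs)

lemma cutSlope_eq_one {η s : ℝ} (hη : 0 < η) (hs : 2 * η ≤ s) :
    Real.smoothTransition (s / η - 1) = 1 :=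
  Real.smoothTransition.one_of_one_le (by rw [le_sub_iff_add_le, le_div_iff₀ hη]; linarith)

lemma cutPrim_eq_zero {η s : ℝ} (hη : 0 < η) (hs : s ≤ η) : cutPrim η s = 0 := by
  apply intervalIntegral.integral_zero_ae
  filter_upwards with t ht
  apply cutSlope_eq_zero hη
  exact ht.2.trans (max_le hη.le hs)

lemma cutPrim_nonneg {η s : ℝ} (hs : 0 ≤ s) : 0 ≤ cutPrim η s :=
  intervalIntegral.integral_nonneg hs fun _ _ => Real.smoothTransition.nonneg _

lemma cutPrim_le {η s : ℝ} (hη : 0 < η) (hs : 0 ≤ s) :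
    cutPrim η s ≤ s * Real.smoothTransition (s / η - 1) := by
  have := intervalIntegral.integral_mono_on (μ := volume) hs
    ((continuous_cutSlope η).intervalIntegrable 0 s)
    (intervalIntegrable_const (c := Real.smoothTransition (s / η - 1)))
    (fun _ ht => Real.smoothTransition.monotone (by gcongr; exact ht.2))
  simpa [cutPrim] using this

lemma hasLineDerivAt_comp {E : Type*} [NormedAddCommGroup E] [NormedSpace ℝ E]
    {g : ℝ → ℝ} {f : E → ℝ} {g' f' : ℝ} {y v : E}
    (hg : HasDerivAt g g' (f y)) (hf : HasLineDerivAt ℝ f f' y v) :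
    HasLineDerivAt ℝ (fun z => g (f z)) (g' * f') y v := by
  unfold HasLineDerivAt at *
  refine HasDerivAt.comp (0 : ℝ) (h₂ := g) (h := fun t : ℝ => f (y + t • v)) ?_ hf
  simpa using hg

lemma continuous_of_continuousOn_ball_of_eq_zero {E : Type*} [NormedAddCommGroup E]
    {f : E → ℝ} {R : ℝ} (hR : R < 1) (hf : ContinuousOn f (ball 0 1))
    (h0 : ∀ y, R < ‖y‖ → f y = 0) : Continuous f := by
  rw [continuous_iff_continuousAt]
  intro y
  by_cases hy : y ∈ ball (0 : E) 1
  · exact hf.continuousAt (isOpen_ball.mem_nhds hy)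
  · have h1 : R < ‖y‖ := by
      rw [mem_ball_zero_iff, not_lt] at hy; linarith
    have h2 : ∀ᶠ z in nhds y, f z = 0 := by
      filter_upwards [(isOpen_lt continuous_const continuous_norm).mem_nhds h1] with z hz
      exact h0 z hz
    exact (continuousAt_const (y := (0 : ℝ))).congr (by filter_upwards [h2] with z hz using hz.symm)

lemma integrable_of_continuousOn_ball_of_eq_zero {N : ℕ} {f : EuclideanSpace ℝ (Fin N) → ℝ}
    {R : ℝ} (hR : R < 1) (hf : ContinuousOn f (ball 0 1))
    (h0 : ∀ y, R < ‖y‖ → f y = 0) : Integrable f := by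
  apply (continuous_of_continuousOn_ball_of_eq_zero hR hf h0).integrable_of_hasCompactSupport
  apply HasCompactSupport.of_support_subset_isCompact (isCompact_closedBall 0 R)
  intro y hy
  rw [mem_closedBall_zero_iff]
  by_contra h
  exact hy (h0 y (not_le.1 h))

lemma tsupport_subset_ball {E : Type*} [NormedAddCommGroup E] {f : E → ℝ} {R : ℝ} (hR : R < 1)
    (h0 : ∀ y, R < ‖y‖ → f y = 0) : tsupport f ⊆ ball 0 1 := by
  refine (closure_minimal (t := closedBall 0 R) ?_ isClosed_closedBall).trans ?_
  · intro y hy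
    rw [mem_closedBall_zero_iff]
    by_contra h
    exact hy (h0 y (not_le.1 h))
  · exact closedBall_subset_ball hR

/-- Green's second identity against a compactly supported function in the unit ball. -/
lemma integral_mul_lap_sub_eq_zero {N : ℕ} {u ψ : EuclideanSpace ℝ (Fin N) → ℝ}
    {ψ₁ ψ₂ : Fin N → EuclideanSpace ℝ (Fin N) → ℝ} {R : ℝ} (hR : R < 1)
    (hu : ContDiffOn ℝ 2 u (ball 0 1))
    (h1 : ∀ i y, HasLineDerivAt ℝ ψ (ψ₁ i y) y (EuclideanSpace.single i 1))
    (h2 : ∀ i y, HasLineDerivAt ℝ (ψ₁ i) (ψ₂ i y) y (EuclideanSpace.single i 1))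
    (hc : Continuous ψ) (hc1 : ∀ i, Continuous (ψ₁ i)) (hc2 : ∀ i, Continuous (ψ₂ i))
    (hz : ∀ y, R < ‖y‖ → ψ y = 0) (hz1 : ∀ i y, R < ‖y‖ → ψ₁ i y = 0)
    (hz2 : ∀ i y, R < ‖y‖ → ψ₂ i y = 0) :
    Integrable (fun y => u y * (∑ i, ψ₂ i y) - ψ y * lap u y) ∧
      ∫ y, (u y * (∑ i, ψ₂ i y) - ψ y * lap u y) = 0 := by
  have hfd : ContDiffOn ℝ 1 (fderiv ℝ u) (ball 0 1) :=
    hu.fderiv_of_isOpen isOpen_ball (by norm_num)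
  have hd1 : ∀ i : Fin N, ContDiffOn ℝ 1 (fun y => fderiv ℝ u y (EuclideanSpace.single i 1))
      (ball 0 1) := fun i => hfd.clm_apply contDiffOn_const
  have hd2 : ∀ i : Fin N, ContinuousOn
      (fun x => fderiv ℝ (fun y => fderiv ℝ u y (EuclideanSpace.single i 1)) x
        (EuclideanSpace.single i 1)) (ball 0 1) := fun i =>
    ((hd1 i).continuousOn_fderiv_of_isOpen isOpen_ball (by norm_num)).clm_apply continuousOn_const
  have iA : ∀ i, Integrable fun x => ψ x *
      fderiv ℝ (fun y => fderiv ℝ u y (EuclideanSpace.single i 1)) x (EuclideanSpace.single i 1) :=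
    fun i => integrable_of_continuousOn_ball_of_eq_zero hR (hc.continuousOn.mul (hd2 i))
      (fun y hy => by rw [hz y hy, zero_mul])
  have iB : ∀ i, Integrable fun x => ψ₁ i x * fderiv ℝ u x (EuclideanSpace.single i 1) :=
    fun i => integrable_of_continuousOn_ball_of_eq_zero hR
      ((hc1 i).continuousOn.mul (hd1 i).continuousOn) (fun y hy => by rw [hz1 i y hy, zero_mul])
  have iC : ∀ i, Integrable fun x => ψ₂ i x * u x :=
    fun i => integrable_of_continuousOn_ball_of_eq_zero hR
      ((hc2 i).continuousOn.mul hu.continuousOn) (fun y hy => by rw [hz2 i y hy, zero_mul])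
  have iD : ∀ i : Fin N, Integrable fun x => ψ x * fderiv ℝ u x (EuclideanSpace.single i 1) :=
    fun i => integrable_of_continuousOn_ball_of_eq_zero hR
      (hc.continuousOn.mul (hd1 i).continuousOn) (fun y hy => by rw [hz y hy, zero_mul])
  have iE : ∀ i, Integrable fun x => ψ₁ i x * u x :=
    fun i => integrable_of_continuousOn_ball_of_eq_zero hR
      ((hc1 i).continuousOn.mul hu.continuousOn) (fun y hy => by rw [hz1 i y hy, zero_mul])
  have s1 : ∀ i, ∫ x, ψ x * fderiv ℝ (fun y => fderiv ℝ u y (EuclideanSpace.single i 1)) x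
      (EuclideanSpace.single i 1) = - ∫ x, ψ₁ i x * fderiv ℝ u x (EuclideanSpace.single i 1) := by
    intro i
    refine integral_bilinear_hasLineDerivAt_right_eq_neg_left_of_integrable
      (B := ContinuousLinearMap.mul ℝ ℝ) (v := EuclideanSpace.single i (1 : ℝ))
      (iB i) (iA i) (iD i) (fun x _ => h1 i x) (fun x hx => ?_)
    have hx' := tsupport_subset_ball hR hz hx
    exact (((hd1 i).contDiffAt (isOpen_ball.mem_nhds hx')).differentiableAt
      (by norm_num)).hasFDerivAt.hasLineDerivAt _
  have s2 : ∀ i, ∫ x, ψ₁ i x * fderiv ℝ u x (EuclideanSpace.single i 1) =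
      - ∫ x, ψ₂ i x * u x := by
    intro i
    refine integral_bilinear_hasLineDerivAt_right_eq_neg_left_of_integrable
      (B := ContinuousLinearMap.mul ℝ ℝ) (v := EuclideanSpace.single i (1 : ℝ))
      (iC i) (iB i) (iE i) (fun x _ => h2 i x) (fun x hx => ?_)
    have hx' := tsupport_subset_ball hR (hz1 i) hx
    exact ((hu.contDiffAt (isOpen_ball.mem_nhds hx')).differentiableAt
      (by norm_num)).hasFDerivAt.hasLineDerivAt _
  have e : (fun y => u y * (∑ i, ψ₂ i y) - ψ y * lap u y) = fun y => ∑ i, (ψ₂ i y * u y - ψ y *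
      fderiv ℝ (fun y => fderiv ℝ u y (EuclideanSpace.single i 1)) y
        (EuclideanSpace.single i 1)) := by
    ext y
    rw [lap, Finset.sum_sub_distrib, Finset.mul_sum, Finset.mul_sum]
    congr 1
    exact Finset.sum_congr rfl fun i _ => mul_comm _ _
  rw [e]
  refine ⟨integrable_finsetSum _ fun i _ => (iC i).sub (iA i), ?_⟩
  rw [integral_finsetSum _ fun i _ => by exact (iC i).sub (iA i)]
  apply Finset.sum_eq_zero
  intro i _
  rw [integral_sub (iC i) (iA i), s1 i, s2 i]
  ring

lemma deriv_smoothTransition_eq_zero {s : ℝ} (hs : s ≤ 0) : deriv Real.smoothTransition s = 0 := by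
  apply IsLocalMin.deriv_eq_zero
  filter_upwards with t
  rw [Real.smoothTransition.zero_of_nonpos hs]
  exact Real.smoothTransition.nonneg t

/-- A quadratic polynomial in `y` with leading part `a ‖y‖²` and linear part `-2 ⟪x, y⟫`. -/
noncomputable def quad {N : ℕ} (a c : ℝ) (x y : EuclideanSpace ℝ (Fin N)) : ℝ :=
  a * ‖y‖ ^ 2 - 2 * inner ℝ x y + c

lemma continuous_quad {N : ℕ} (a c : ℝ) (x : EuclideanSpace ℝ (Fin N)) :
    Continuous (quad a c x) := by
  unfold quad; fun_prop

lemma hasLineDerivAt_quad {N : ℕ} (a c : ℝ) (x y : EuclideanSpace ℝ (Fin N)) (i : Fin N) :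
    HasLineDerivAt ℝ (quad a c x) (2 * a * y i - 2 * x i) y (EuclideanSpace.single i 1) := by
  have e : ∀ t : ℝ, quad a c x (y + t • EuclideanSpace.single i 1) =
      quad a c x y + t * (2 * a * y i - 2 * x i) + a * t ^ 2 := by
    intro t
    unfold quad
    rw [norm_add_sq_real, inner_add_right, inner_smul_right, inner_smul_right, norm_smul]
    simp only [EuclideanSpace.inner_single_right, PiLp.norm_single, mul_pow]
    simp
    ring
  unfold HasLineDerivAt
  simp_rw [e]
  have h := ((((hasDerivAt_id (0 : ℝ)).mul_const (2 * a * y i - 2 * x i)).const_add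
    (quad a c x y)).add (((hasDerivAt_id (0 : ℝ)).pow 2).const_mul a))
  refine h.congr_deriv ?_
  simp

lemma hasLineDerivAt_quad_slope {N : ℕ} (a : ℝ) (x y : EuclideanSpace ℝ (Fin N)) (i : Fin N) :
    HasLineDerivAt ℝ (fun z : EuclideanSpace ℝ (Fin N) => 2 * a * z i - 2 * x i) (2 * a) y
      (EuclideanSpace.single i 1) := by
  unfold HasLineDerivAt
  have e : ∀ t : ℝ, 2 * a * (y + t • EuclideanSpace.single i (1 : ℝ) : EuclideanSpace ℝ (Fin N)) i
      - 2 * x i = (2 * a * y i - 2 * x i) + t * (2 * a) := by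
    intro t; simp; ring
  simp_rw [e]
  simpa using ((hasDerivAt_id (0 : ℝ)).mul_const (2 * a)).const_add (2 * a * y i - 2 * x i)

lemma sum_quad_slope_sq {N : ℕ} (a c : ℝ) (x y : EuclideanSpace ℝ (Fin N)) :
    ∑ i, (2 * a * y i - 2 * x i) ^ 2 = 4 * (a * (quad a c x y - c) + ‖x‖ ^ 2) := by
  have h1 : ‖y‖ ^ 2 = ∑ i, y i ^ 2 := by simp [EuclideanSpace.norm_sq_eq]
  have h2 : ‖x‖ ^ 2 = ∑ i, x i ^ 2 := by simp [EuclideanSpace.norm_sq_eq]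
  have h3 : inner ℝ x y = ∑ i, x i * y i := by
    simp [PiLp.inner_apply, mul_comm]
  rw [quad, h1, h2, h3]
  simp only [Finset.mul_sum, mul_add, mul_sub, add_sub_cancel_right,
    ← Finset.sum_sub_distrib, ← Finset.sum_add_distrib]
  exact Finset.sum_congr rfl fun i _ => by ring

lemma hasLineDerivAt_mul {E : Type*} [NormedAddCommGroup E] [NormedSpace ℝ E]
    {f g : E → ℝ} {f' g' : ℝ} {y v : E}
    (hf : HasLineDerivAt ℝ f f' y v) (hg : HasLineDerivAt ℝ g g' y v) :
    HasLineDerivAt ℝ (fun z => f z * g z) (f' * g y + f y * g') y v := by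
  unfold HasLineDerivAt at *
  simpa using HasDerivAt.fun_mul hf hg

set_option maxHeartbeats 1000000 in
/-- A compactly supported approximate subsolution of `-Δ + K` on the unit ball, with an
approximate pole at `x` and Green-type bounds that are linear in the distance to the boundary. -/
lemma exists_test_function {N : ℕ} (hN : 2 ≤ N) {l K ρ η : ℝ} (hl : 0 < l) (hK : 0 ≤ K)
    (hKl : K ≤ l ^ 2) (hρ : 0 < ρ) (hρ1 : ρ ≤ 1) (hη : 0 < η)
    {x : EuclideanSpace ℝ (Fin N)} (hx : ‖x‖ < 1) :
    ∃ (ψ θ : EuclideanSpace ℝ (Fin N) → ℝ) (ψ₁ ψ₂ : Fin N → EuclideanSpace ℝ (Fin N) → ℝ)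
      (R : ℝ), R < 1 ∧
      (∀ i y, HasLineDerivAt ℝ ψ (ψ₁ i y) y (EuclideanSpace.single i 1)) ∧
      (∀ i y, HasLineDerivAt ℝ (ψ₁ i) (ψ₂ i y) y (EuclideanSpace.single i 1)) ∧
      Continuous ψ ∧ (∀ i, Continuous (ψ₁ i)) ∧ (∀ i, Continuous (ψ₂ i)) ∧
      (∀ y, R < ‖y‖ → ψ y = 0) ∧ (∀ i y, R < ‖y‖ → ψ₁ i y = 0) ∧
      (∀ i y, R < ‖y‖ → ψ₂ i y = 0) ∧
      ∀ y, ‖y‖ < 1 → 0 ≤ ψ y ∧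
        ψ y ≤ 4 * (1 - ‖x‖ ^ 2) * (‖y - x‖ ^ 2 + ρ) ^ ((1 : ℝ) / 2 - N / 2) ∧
        0 ≤ θ y ∧ θ y ≤ 1 ∧
        K * ψ y + θ y * (4 * profileExcess (N / 2) l 5 * (1 - ‖x‖ ^ 2) -
          4 * ρ * ((N / 2 + 1) * (‖y - x‖ ^ 2 + ρ) ^ (-(N / 2 : ℝ) - 1))) ≤ ∑ i, ψ₂ i y ∧
        (2 * η ≤ (1 - ‖x‖ ^ 2) * (1 - ‖y‖ ^ 2) * profile (N / 2) l 5 → θ y = 1) := by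
  set n : ℝ := (N : ℝ) / 2 with hn
  have hn1 : 1 ≤ n := by
    have : (2 : ℝ) ≤ N := by exact_mod_cast hN
    rw [hn]; linarith
  set a : ℝ := ‖x‖ ^ 2 with ha
  have ha0 : 0 ≤ a := by positivity
  have ha1 : a < 1 := by rw [ha]; nlinarith [norm_nonneg x]
  set Q₁ := quad 1 (a + ρ) x with hQ₁
  set Q₂ := quad a (1 + ρ) x with hQ₂
  have eQ₁ : ∀ y, Q₁ y = ‖y - x‖ ^ 2 + ρ := by
    intro y
    rw [hQ₁, quad, norm_sub_sq_real, real_inner_comm]; ring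
  have pQ₁ : ∀ y, ρ ≤ Q₁ y := by
    intro y; rw [eQ₁]; have := sq_nonneg ‖y - x‖; linarith
  have lQ₂ : ∀ y, (1 - ‖x‖ * ‖y‖) ^ 2 + ρ ≤ Q₂ y := by
    intro y
    rw [hQ₂, quad]
    have := real_inner_le_norm x y
    nlinarith
  have pQ₂ : ∀ y, ρ ≤ Q₂ y := by
    intro y; have := lQ₂ y; have := sq_nonneg (1 - ‖x‖ * ‖y‖); linarith
  have p₁ : ∀ y, 0 < Q₁ y := fun y => hρ.trans_le (pQ₁ y)
  have p₂ : ∀ y, 0 < Q₂ y := fun y => hρ.trans_le (pQ₂ y)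
  have dQ : ∀ y, Q₂ y - Q₁ y = (1 - a) * (1 - ‖y‖ ^ 2) := by
    intro y; rw [hQ₁, hQ₂, quad, quad]; ring
  have cQ₁ : Continuous Q₁ := continuous_quad _ _ _
  have cQ₂ : Continuous Q₂ := continuous_quad _ _ _
  have cF₁ : Continuous fun y => profile n l (Q₁ y) :=
    (continuousOn_profile n l).comp_continuous cQ₁ p₁
  have cF₂ : Continuous fun y => profile n l (Q₂ y) :=
    (continuousOn_profile n l).comp_continuous cQ₂ p₂
  have cG : ContinuousOn (profileSlope n l) (Ioi 0) := by
    unfold profileSlope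
    intro t ht
    have ht' : t ≠ 0 := (mem_Ioi.1 ht).ne'
    apply ContinuousAt.continuousWithinAt
    have := Real.continuousAt_rpow_const t (-n - 1) (Or.inl ht')
    have := Real.continuousAt_rpow_const t (-n - 1 / 2) (Or.inl ht')
    fun_prop
  have cG₁ : Continuous fun y => profileSlope n l (Q₁ y) := cG.comp_continuous cQ₁ p₁
  have cG₂ : Continuous fun y => profileSlope n l (Q₂ y) := cG.comp_continuous cQ₂ p₂
  set φ : EuclideanSpace ℝ (Fin N) → ℝ :=
    fun y => profilePrim n l (Q₁ y) - profilePrim n l (Q₂ y) with hφ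
  have cf : ContinuousOn (profilePrim n l) (Ioi 0) := fun t ht =>
    (hasDerivAt_profilePrim n l ht).continuousAt.continuousWithinAt
  have cφ : Continuous φ := (cf.comp_continuous cQ₁ p₁).sub (cf.comp_continuous cQ₂ p₂)
  set φ₁ : Fin N → EuclideanSpace ℝ (Fin N) → ℝ := fun i y =>
    -profile n l (Q₁ y) * (2 * 1 * y i - 2 * x i) - -profile n l (Q₂ y) * (2 * a * y i - 2 * x i)
    with hφ₁
  set φ₂ : Fin N → EuclideanSpace ℝ (Fin N) → ℝ := fun i y =>
    (- (-profileSlope n l (Q₁ y)) * (2 * 1 * y i - 2 * x i) * (2 * 1 * y i - 2 * x i)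
      + -profile n l (Q₁ y) * (2 * 1)) -
    (- (-profileSlope n l (Q₂ y)) * (2 * a * y i - 2 * x i) * (2 * a * y i - 2 * x i)
      + -profile n l (Q₂ y) * (2 * a)) with hφ₂
  have cφ₁ : ∀ i, Continuous (φ₁ i) := by intro i; rw [hφ₁]; fun_prop
  have cφ₂ : ∀ i, Continuous (φ₂ i) := by intro i; rw [hφ₂]; fun_prop
  have dφ : ∀ i y, HasLineDerivAt ℝ φ (φ₁ i y) y (EuclideanSpace.single i 1) := by
    intro i y
    exact HasDerivAt.sub
      (hasLineDerivAt_comp (hasDerivAt_profilePrim n l (p₁ y)) (hasLineDerivAt_quad 1 _ x y i))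
      (hasLineDerivAt_comp (hasDerivAt_profilePrim n l (p₂ y)) (hasLineDerivAt_quad a _ x y i))
  have dφ₁ : ∀ i y, HasLineDerivAt ℝ (φ₁ i) (φ₂ i y) y (EuclideanSpace.single i 1) := by
    intro i y
    exact HasDerivAt.sub
      (hasLineDerivAt_mul (hasLineDerivAt_comp (hasDerivAt_profile n l (p₁ y)).neg
        (hasLineDerivAt_quad 1 _ x y i)) (hasLineDerivAt_quad_slope 1 x y i))
      (hasLineDerivAt_mul (hasLineDerivAt_comp (hasDerivAt_profile n l (p₂ y)).neg
        (hasLineDerivAt_quad a _ x y i)) (hasLineDerivAt_quad_slope a x y i))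
  have sφ₂ : ∀ y, ∑ i, φ₂ i y =
      4 * profileExcess n l (Q₁ y) - 4 * ρ * profileSlope n l (Q₁ y) -
        a * (4 * profileExcess n l (Q₂ y) - 4 * ρ * profileSlope n l (Q₂ y)) := by
    intro y
    have e : ∑ i, φ₂ i y = profileSlope n l (Q₁ y) * ∑ i, (2 * 1 * y i - 2 * x i) ^ 2
        - profile n l (Q₁ y) * (2 * N) - (profileSlope n l (Q₂ y) *
        ∑ i, (2 * a * y i - 2 * x i) ^ 2 - profile n l (Q₂ y) * (2 * a * N)) := by
      have : ∀ i, φ₂ i y = (profileSlope n l (Q₁ y) * (2 * 1 * y i - 2 * x i) ^ 2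
        - profile n l (Q₁ y) * 2) - (profileSlope n l (Q₂ y) *
        (2 * a * y i - 2 * x i) ^ 2 - profile n l (Q₂ y) * (2 * a)) := by
        intro i; rw [hφ₂]; ring
      simp only [this, Finset.sum_sub_distrib, Finset.mul_sum, Finset.sum_const, Finset.card_univ,
        Fintype.card_fin, nsmul_eq_mul]
      ring
    have hN' : (N : ℝ) = 2 * n := by rw [hn]; ring
    rw [e, sum_quad_slope_sq 1 (a + ρ), sum_quad_slope_sq a (1 + ρ), ← hQ₁, ← hQ₂, ← ha,
      ← profileExcess_eq n l (p₁ y), ← profileExcess_eq n l (p₂ y), hN']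
    ring
  set R : ℝ := 1 - η / (2 * profile n l ρ) with hR
  have hFρ : 0 < profile n l ρ := profile_pos hρ
  have φ_small : ∀ y, R < ‖y‖ → φ y ≤ η := by
    intro y hy
    rcases le_or_gt 1 ‖y‖ with h | h
    · have h1 : Q₂ y ≤ Q₁ y := by
        have h2 : (1 - a) * (1 - ‖y‖ ^ 2) ≤ 0 :=
          mul_nonpos_of_nonneg_of_nonpos (by linarith) (by nlinarith)
        linarith [dQ y]
      have := profilePrim_antitoneOn n l (p₂ y) (p₁ y) h1
      simp only [hφ]; linarith
    · have h0 := norm_nonneg y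
      have h2 : 0 ≤ 1 - ‖y‖ ^ 2 := by nlinarith
      have h1 : Q₁ y ≤ Q₂ y := by
        have := mul_nonneg (sub_nonneg.2 ha1.le) h2
        linarith [dQ y]
      calc φ y ≤ (Q₂ y - Q₁ y) * profile n l (Q₁ y) :=
            profilePrim_sub_le_mul (by linarith) hl.le (p₁ y) h1
        _ ≤ (2 * (1 - ‖y‖)) * profile n l ρ := by
            apply mul_le_mul _ _ (profile_pos (p₁ y)).le (by linarith)
            · rw [dQ]; nlinarith
            · exact profile_antitoneOn (by linarith) hl.le hρ (p₁ y) (pQ₁ y)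
        _ ≤ 2 * (η / (2 * profile n l ρ)) * profile n l ρ := by
            gcongr; linarith
        _ = η := by field_simp
  refine ⟨fun y => cutPrim η (φ y), fun y => Real.smoothTransition (φ y / η - 1),
    fun i y => Real.smoothTransition (φ y / η - 1) * φ₁ i y,
    fun i y => deriv Real.smoothTransition (φ y / η - 1) * (1 / η) * φ₁ i y * φ₁ i y +
      Real.smoothTransition (φ y / η - 1) * φ₂ i y, R, ?_, ?_, ?_, ?_, ?_, ?_, ?_, ?_, ?_, ?_⟩
  · rw [hR]
    have : 0 < η / (2 * profile n l ρ) := by positivity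
    linarith
  · intro i y
    exact hasLineDerivAt_comp (hasDerivAt_cutPrim η (φ y)) (dφ i y)
  · intro i y
    exact hasLineDerivAt_mul (hasLineDerivAt_comp
      (g := fun t : ℝ => Real.smoothTransition (t / η - 1))
      (hasDerivAt_cutSlope η (φ y)) (dφ i y)) (dφ₁ i y)
  · exact (continuous_cutPrim η).comp cφ
  · intro i
    exact ((continuous_cutSlope η).comp cφ).mul (cφ₁ i)
  · intro i
    have h1 : Continuous fun y => deriv Real.smoothTransition (φ y / η - 1) :=
      continuous_deriv_smoothTransition.comp (by fun_prop)
    have h2 : Continuous fun y => Real.smoothTransition (φ y / η - 1) :=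
      (continuous_cutSlope η).comp cφ
    have := cφ₁ i
    have := cφ₂ i
    fun_prop
  · intro y hy
    exact cutPrim_eq_zero hη (φ_small y hy)
  · intro i y hy
    simp only [cutSlope_eq_zero hη (φ_small y hy), zero_mul]
  · intro i y hy
    have : φ y / η - 1 ≤ 0 := by
      rw [sub_nonpos, div_le_one hη]; exact φ_small y hy
    simp only [cutSlope_eq_zero hη (φ_small y hy), deriv_smoothTransition_eq_zero this, zero_mul,
      add_zero]
  · intro y hy
    have h0 := norm_nonneg y
    have hx0 := norm_nonneg x
    have hy2 : 0 ≤ 1 - ‖y‖ ^ 2 := by nlinarith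
    have h12 : Q₁ y ≤ Q₂ y := by
      have := mul_nonneg (sub_nonneg.2 ha1.le) hy2
      linarith [dQ y]
    have hQ5 : Q₂ y ≤ 5 := by
      rw [hQ₂, quad]
      have h1 := neg_le_of_abs_le (abs_real_inner_le_norm x y)
      have h2 : ‖x‖ * ‖y‖ ≤ 1 := by nlinarith
      have h3 : a * ‖y‖ ^ 2 ≤ 1 := by nlinarith
      linarith
    have hφ0 : 0 ≤ φ y := by
      have := profilePrim_antitoneOn n l (p₁ y) (p₂ y) h12
      simp only [hφ]; linarith
    have hθ0 := Real.smoothTransition.nonneg (φ y / η - 1)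
    have hθ1 := Real.smoothTransition.le_one (φ y / η - 1)
    have hψ := cutPrim_le hη hφ0
    refine ⟨cutPrim_nonneg hφ0, ?_, hθ0, hθ1, ?_, ?_⟩
    · have h1 : φ y ≤ 2 * Q₁ y ^ (1 / 2 - n) * (√(Q₂ y) - √(Q₁ y)) :=
        profilePrim_sub_le (by linarith) hl.le (p₁ y) h12
      have h2 : √(Q₂ y) - √(Q₁ y) ≤ 2 * (1 - a) := by
        have s2 : 1 - ‖y‖ ≤ √(Q₂ y) := by
          apply Real.le_sqrt_of_sq_le
          have h4 : 1 - ‖y‖ ≤ 1 - ‖x‖ * ‖y‖ := by nlinarith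
          nlinarith [lQ₂ y]
        have s0 : 0 < √(Q₁ y) := Real.sqrt_pos.2 (p₁ y)
        have e1 := Real.sq_sqrt (p₁ y).le
        have e2 := Real.sq_sqrt (p₂ y).le
        have e3 : (√(Q₂ y) - √(Q₁ y)) * (√(Q₂ y) + √(Q₁ y)) = (1 - a) * (1 - ‖y‖ ^ 2) := by
          rw [← dQ]; linear_combination e2 - e1
        have e4 : (1 - a) * (1 - ‖y‖ ^ 2) ≤ (2 * (1 - a)) * (√(Q₂ y) + √(Q₁ y)) := by
          have h5 : 1 - ‖y‖ ^ 2 ≤ 2 * (√(Q₂ y) + √(Q₁ y)) := by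
            have : 1 - ‖y‖ ^ 2 ≤ 2 * (1 - ‖y‖) := by
              linear_combination sq_nonneg (1 - ‖y‖)
            linarith
          have h6 := mul_le_mul_of_nonneg_left h5 (sub_nonneg.2 ha1.le)
          linarith
        rw [← e3] at e4
        exact le_of_mul_le_mul_right e4 (by linarith [Real.sqrt_nonneg (Q₂ y)])
      have h3 : 0 ≤ Q₁ y ^ (1 / 2 - n) := Real.rpow_nonneg (p₁ y).le _
      rw [← eQ₁]
      calc cutPrim η (φ y) ≤ φ y * 1 := hψ.trans (by gcongr)
        _ ≤ 2 * Q₁ y ^ (1 / 2 - n) * (2 * (1 - a)) := by rw [mul_one]; exact h1.trans (by gcongr)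
        _ = _ := by ring
    · rw [← eQ₁, Finset.sum_add_distrib, ← Finset.mul_sum, sφ₂]
      have hA : 0 ≤ ∑ i, deriv Real.smoothTransition (φ y / η - 1) * (1 / η) * φ₁ i y * φ₁ i y := by
        apply Finset.sum_nonneg
        intro i _
        have := deriv_smoothTransition_nonneg (φ y / η - 1)
        rw [mul_assoc]
        exact mul_nonneg (by positivity) (mul_self_nonneg _)
      have hB : K * φ y ≤ 4 * (profileExcess n l (Q₁ y) - profileExcess n l (Q₂ y)) :=
        mul_profilePrim_sub_le (by linarith) hl.le hKl (p₁ y) h12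
      have hC : profileExcess n l 5 ≤ profileExcess n l (Q₂ y) :=
        profileExcess_antitoneOn (by linarith) hl.le (p₂ y) (by norm_num) hQ5
      have hD := profileSlope_le (n := n) (by linarith) hl.le (p₁ y)
      have hE := profileSlope_nonneg (n := n) (by linarith) hl.le (p₂ y)
      have hF : K * cutPrim η (φ y) ≤ Real.smoothTransition (φ y / η - 1) * (K * φ y) := by
        calc _ ≤ K * (φ y * Real.smoothTransition (φ y / η - 1)) := by gcongr
          _ = _ := by ring
      have hG : K * φ y + (4 * profileExcess n l 5 * (1 - a) -
          4 * ρ * ((n + 1) * Q₁ y ^ (-n - 1))) ≤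
          4 * profileExcess n l (Q₁ y) - 4 * ρ * profileSlope n l (Q₁ y) -
            a * (4 * profileExcess n l (Q₂ y) - 4 * ρ * profileSlope n l (Q₂ y)) := by
        have g1 : 4 * ρ * profileSlope n l (Q₁ y) ≤ 4 * ρ * ((n + 1) * Q₁ y ^ (-n - 1)) := by
          gcongr
        have g2 : 0 ≤ a * (4 * ρ * profileSlope n l (Q₂ y)) := by positivity
        have g3 : 4 * profileExcess n l 5 * (1 - a) ≤ 4 * profileExcess n l (Q₂ y) * (1 - a) := by
          have : 0 ≤ 1 - a := by linarith
          gcongr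
        linarith
      have hH := mul_le_mul_of_nonneg_left hG hθ0
      linarith
    · intro h
      apply cutSlope_eq_one hη
      have h1 : (Q₂ y - Q₁ y) * profile n l (Q₂ y) ≤ φ y :=
        le_profilePrim_sub (by linarith) hl.le (p₁ y) h12
      have h2 : profile n l 5 ≤ profile n l (Q₂ y) :=
        profile_antitoneOn (by linarith) hl.le (p₂ y) (by norm_num) hQ5
      rw [← dQ] at h
      have h3 : 0 ≤ Q₂ y - Q₁ y := by linarith
      exact (h.trans (by gcongr)).trans h1

lemma memLp_ofReal_of_integrable_rpow {α : Type*} [MeasurableSpace α] {μ : Measure α} {f : α → ℝ}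
    {p : ℝ} (hp : 0 < p) (hf : AEStronglyMeasurable f μ) (hf0 : 0 ≤ᵐ[μ] f)
    (hfp : Integrable (fun x => f x ^ p) μ) : MemLp f (ENNReal.ofReal p) μ := by
  rw [← integrable_norm_rpow_iff hf (by simpa using hp) ENNReal.ofReal_ne_top,
    ENNReal.toReal_ofReal hp.le]
  refine hfp.congr ?_
  filter_upwards [hf0] with x hx
  rw [Real.norm_of_nonneg hx]

/-- Hölder's inequality for nonnegative functions with integrable powers. -/
lemma integrable_mul_and_integral_mul_le {α : Type*} [MeasurableSpace α] {μ : Measure α}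
    {f g : α → ℝ} {p q : ℝ} (hpq : p.HolderConjugate q)
    (hf : AEStronglyMeasurable f μ) (hg : AEStronglyMeasurable g μ)
    (hf0 : 0 ≤ᵐ[μ] f) (hg0 : 0 ≤ᵐ[μ] g)
    (hfp : Integrable (fun x => f x ^ p) μ) (hgq : Integrable (fun x => g x ^ q) μ) :
    Integrable (fun x => f x * g x) μ ∧
      ∫ x, f x * g x ∂μ ≤ (∫ x, f x ^ p ∂μ) ^ (1 / p) * (∫ x, g x ^ q ∂μ) ^ (1 / q) := by
  have h1 := memLp_ofReal_of_integrable_rpow hpq.pos hf hf0 hfp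
  have h2 := memLp_ofReal_of_integrable_rpow hpq.symm.pos hg hg0 hgq
  have := hpq.ennrealOfReal
  exact ⟨h1.integrable_mul h2, integral_mul_le_Lp_mul_Lq_of_nonneg hpq hf0 hg0 h1 h2⟩

lemma exists_forall_integral_kernel_le {N : ℕ} :
    ∃ C : ℝ, 0 ≤ C ∧ ∀ ρ : ℝ, 0 < ρ → ∀ x : EuclideanSpace ℝ (Fin N),
      Integrable (fun y => ρ * (‖y - x‖ ^ 2 + ρ) ^ (-(N / 2 : ℝ) - 1)) ∧
      ∫ y, ρ * (‖y - x‖ ^ 2 + ρ) ^ (-(N / 2 : ℝ) - 1) ≤ C := by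
  set f : EuclideanSpace ℝ (Fin N) → ℝ := fun z => (1 + ‖z‖ ^ 2) ^ (-((N : ℝ) + 2) / 2) with hf
  have hfi : Integrable f :=
    integrable_rpow_neg_one_add_norm_sq (by simp)
  refine ⟨∫ z, f z, integral_nonneg fun z => by simp only [hf]; positivity, fun ρ hρ x => ?_⟩
  have hs : 0 < √ρ := Real.sqrt_pos.2 hρ
  have key : ∀ y, ρ * (‖y - x‖ ^ 2 + ρ) ^ (-(N / 2 : ℝ) - 1) =
      ρ ^ (-(N / 2 : ℝ)) * f ((√ρ)⁻¹ • (y - x)) := by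
    intro y
    have e : ‖y - x‖ ^ 2 + ρ = ρ * (1 + ‖(√ρ)⁻¹ • (y - x)‖ ^ 2) := by
      rw [norm_smul, mul_pow, norm_inv, Real.norm_of_nonneg hs.le, inv_pow, Real.sq_sqrt hρ.le]
      field_simp
      ring
    rw [e, Real.mul_rpow hρ.le (by positivity), hf, Real.rpow_sub hρ, Real.rpow_one]
    have e' : -((N : ℝ) + 2) / 2 = -(N / 2 : ℝ) - 1 := by ring
    simp only [e']
    field_simp
  simp_rw [key]
  constructor
  · exact ((hfi.comp_smul (inv_ne_zero hs.ne')).comp_sub_right x).const_mul _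
  · rw [integral_const_mul, integral_sub_right_eq_self (fun z => f ((√ρ)⁻¹ • z)) x,
      Measure.integral_comp_inv_smul, finrank_euclideanSpace_fin, abs_of_nonneg (by positivity),
      smul_eq_mul, ← mul_assoc, Real.sqrt_eq_rpow, ← Real.rpow_natCast, ← Real.rpow_mul hρ.le,
      ← Real.rpow_add hρ]
    have : -(N / 2 : ℝ) + 1 / 2 * N = 0 := by ring
    rw [this, Real.rpow_zero, one_mul]

/-- The potential with kernel `‖y - x‖ ^ (1 - N)` maps `L^p` of the unit ball to bounded functions
for `p > N`. -/
lemma exists_forall_integral_potential_le {N : ℕ} (hN : 2 ≤ N) {p : ℝ} (hp : (N : ℝ) < p) :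
    ∃ C : ℝ, 0 ≤ C ∧ ∀ g : EuclideanSpace ℝ (Fin N) → ℝ,
      ContinuousOn g (ball 0 1) → (∀ y, 0 ≤ g y) → IntegrableOn (fun y => g y ^ p) (ball 0 1) →
      ∀ x ∈ ball (0 : EuclideanSpace ℝ (Fin N)) 1,
        IntegrableOn (fun y => ‖y - x‖ ^ (1 - (N : ℝ)) * g y) (ball 0 1) ∧
        ∫ y in ball (0 : EuclideanSpace ℝ (Fin N)) 1, ‖y - x‖ ^ (1 - (N : ℝ)) * g y ≤
          C * (∫ y in ball (0 : EuclideanSpace ℝ (Fin N)) 1, g y ^ p) ^ (1 / p) := by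
  have hN2 : (2 : ℝ) ≤ N := by exact_mod_cast hN
  have : Nonempty (Fin N) := ⟨⟨0, by omega⟩⟩
  have hpq : (Real.conjExponent p).HolderConjugate p :=
    (Real.HolderConjugate.conjExponent (by linarith)).symm
  set q := Real.conjExponent p with hq
  have hqe : q = p / (p - 1) := rfl
  set f : EuclideanSpace ℝ (Fin N) → ℝ := fun z => (‖z‖ ^ (1 - (N : ℝ))) ^ q with hf
  have hfi : IntegrableOn f (ball 0 2) := by
    refine (integrableOn_fun_norm_addHaar (f := fun r : ℝ => (r ^ (1 - (N : ℝ))) ^ q) volume).2 ?_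
    have h : IntegrableOn (fun r : ℝ => r ^ ((N : ℝ) - 1 + (1 - N) * q)) (Ioo 0 2) := by
      rw [intervalIntegral.integrableOn_Ioo_rpow_iff (by norm_num)]
      have h1 : (0 : ℝ) < p - 1 := by linarith
      have h2 : (N : ℝ) - 1 + (1 - N) * q + 1 = (p - N) / (p - 1) := by
        rw [hqe]; field_simp; ring
      have h3 : 0 < (p - N) / (p - 1) := div_pos (by linarith) h1
      linarith
    refine h.congr_fun (fun r hr => ?_) measurableSet_Ioo
    have hr0 : (0 : ℝ) < r := hr.1
    simp only [finrank_euclideanSpace_fin, smul_eq_mul]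
    rw [← Real.rpow_natCast, ← Real.rpow_mul hr0.le, ← Real.rpow_add hr0, Nat.cast_sub (by omega)]
    simp
  have hf0 : ∀ z, 0 ≤ f z := fun z => by simp only [hf]; positivity
  refine ⟨(∫ z in ball (0 : EuclideanSpace ℝ (Fin N)) 2, f z) ^ (1 / q),
    Real.rpow_nonneg (integral_nonneg hf0) _, fun g hg hg0 hgp x hx => ?_⟩
  have hsub : ball (0 : EuclideanSpace ℝ (Fin N)) 1 ⊆ (fun y => y - x) ⁻¹' ball 0 2 := by
    intro y hy
    simp only [mem_ball, dist_zero_right, mem_preimage] at *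
    linarith [norm_sub_le y x]
  have hmp := measurePreserving_sub_right (volume : Measure (EuclideanSpace ℝ (Fin N))) x
  have hme : MeasurableEmbedding (fun y : EuclideanSpace ℝ (Fin N) => y - x) :=
    (Homeomorph.subRight x).measurableEmbedding
  have h1 : IntegrableOn (fun y => f (y - x)) ((fun y => y - x) ⁻¹' ball 0 2) :=
    (hmp.integrableOn_comp_preimage hme).2 hfi
  have h2 := h1.mono_set hsub
  have h3 : ∫ y in ball (0 : EuclideanSpace ℝ (Fin N)) 1, f (y - x) ≤
      ∫ z in ball (0 : EuclideanSpace ℝ (Fin N)) 2, f z := by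
    rw [← hmp.setIntegral_preimage_emb hme f]
    exact setIntegral_mono_set h1 (ae_of_all _ fun y => hf0 _) hsub.eventuallyLE
  have hkm : Measurable fun y : EuclideanSpace ℝ (Fin N) => ‖y - x‖ ^ (1 - (N : ℝ)) := by
    fun_prop
  obtain ⟨h4, h5⟩ := integrable_mul_and_integral_mul_le hpq hkm.aestronglyMeasurable
    (hg.aestronglyMeasurable measurableSet_ball)
    (ae_of_all _ fun y => by simp only [Pi.zero_apply]; positivity) (ae_of_all _ hg0) h2 hgp
  refine ⟨h4, h5.trans ?_⟩
  have : 0 ≤ ∫ y in ball (0 : EuclideanSpace ℝ (Fin N)) 1, f (y - x) :=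
    integral_nonneg fun y => hf0 _
  have := hpq.pos
  gcongr
  exact Real.rpow_nonneg (integral_nonneg fun y => Real.rpow_nonneg (hg0 y) _) _

lemma integrableOn_one_sub_norm_rpow {N : ℕ} (hN : 0 < N) {s : ℝ} (hs : -1 < s) :
    IntegrableOn (fun y : EuclideanSpace ℝ (Fin N) => (1 - ‖y‖) ^ s) (ball 0 1) := by
  have : Nonempty (Fin N) := ⟨⟨0, hN⟩⟩
  refine (integrableOn_fun_norm_addHaar (f := fun r : ℝ => (1 - r) ^ s) volume).2 ?_
  have h : IntegrableOn (fun r : ℝ => (1 - r) ^ s) (Ioo 0 1) := by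
    have := (intervalIntegral.intervalIntegrable_rpow' (a := 0) (b := 1) hs).comp_sub_left 1
    simp only [sub_zero, sub_self] at this
    exact ((intervalIntegrable_iff_integrableOn_Ioc_of_le zero_le_one).1 this.symm).mono_set
      Ioo_subset_Ioc_self
  refine Integrable.mono' h (by fun_prop) ?_
  filter_upwards [ae_restrict_mem measurableSet_Ioo] with r hr
  have h1 : 0 ≤ (1 - r) ^ s := Real.rpow_nonneg (by linarith [hr.2]) _
  rw [smul_eq_mul, Real.norm_of_nonneg (mul_nonneg (pow_nonneg hr.1.le _) h1)]
  exact mul_le_of_le_one_left h1 (pow_le_one₀ hr.1.le hr.2.le)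

/-- An `L^1` function divided by the distance to the boundary is in `L^(1/3)`. -/
lemma exists_forall_integral_div_rpow_le {N : ℕ} (hN : 0 < N) :
    ∃ C : ℝ, 0 < C ∧ ∀ u : EuclideanSpace ℝ (Fin N) → ℝ,
      ContinuousOn u (ball 0 1) → (∀ y ∈ ball 0 1, 0 ≤ u y) → IntegrableOn u (ball 0 1) →
      ∀ S ⊆ ball (0 : EuclideanSpace ℝ (Fin N)) 1, MeasurableSet S →
        (∫ y in S, (u y / (1 - ‖y‖)) ^ (1 / 3 : ℝ)) ^ (1 / (1 / 3) : ℝ) ≤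
          C * ∫ y in ball (0 : EuclideanSpace ℝ (Fin N)) 1, u y := by
  have hpq : (3 : ℝ).HolderConjugate (3 / 2) := by constructor <;> norm_num
  have hd := integrableOn_one_sub_norm_rpow hN (s := -(1 / 2)) (by norm_num)
  set J := ∫ y in ball (0 : EuclideanSpace ℝ (Fin N)) 1, (1 - ‖y‖) ^ (-(1 / 2) : ℝ) with hJ
  have hpos : ∀ y ∈ ball (0 : EuclideanSpace ℝ (Fin N)) 1, 0 < 1 - ‖y‖ := by
    intro y hy; simpa using hy
  have hJ0 : 0 ≤ J := setIntegral_nonneg measurableSet_ball fun y hy =>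
    Real.rpow_nonneg (hpos y hy).le _
  refine ⟨J ^ 2 + 1, by positivity, fun u hu hu0 hui S hS hSm => ?_⟩
  have e1 : EqOn u (fun y => (u y ^ (1 / 3 : ℝ)) ^ (3 : ℝ)) (ball 0 1) := fun y hy => by
    simp only
    rw [← Real.rpow_mul (hu0 y hy)]; norm_num
  have e2 : EqOn (fun y : EuclideanSpace ℝ (Fin N) => (1 - ‖y‖) ^ (-(1 / 2) : ℝ))
      (fun y => ((1 - ‖y‖) ^ (-(1 / 3) : ℝ)) ^ (3 / 2 : ℝ)) (ball 0 1) := fun y hy => by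
    simp only
    rw [← Real.rpow_mul (hpos y hy).le]; norm_num
  have e3 : EqOn (fun y => u y ^ (1 / 3 : ℝ) * (1 - ‖y‖) ^ (-(1 / 3) : ℝ))
      (fun y => (u y / (1 - ‖y‖)) ^ (1 / 3 : ℝ)) (ball 0 1) := fun y hy => by
    simp only
    rw [Real.div_rpow (hu0 y hy) (hpos y hy).le, Real.rpow_neg (hpos y hy).le, ← div_eq_mul_inv]
  obtain ⟨h1, h2⟩ := integrable_mul_and_integral_mul_le hpq
    (μ := volume.restrict (ball (0 : EuclideanSpace ℝ (Fin N)) 1))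
    (f := fun y => u y ^ (1 / 3 : ℝ)) (g := fun y => (1 - ‖y‖) ^ (-(1 / 3) : ℝ))
    ((hu.rpow_const fun _ _ => Or.inr (by norm_num)).aestronglyMeasurable measurableSet_ball)
    (Measurable.aestronglyMeasurable (by fun_prop))
    (ae_restrict_of_forall_mem measurableSet_ball fun y hy => Real.rpow_nonneg (hu0 y hy) _)
    (ae_restrict_of_forall_mem measurableSet_ball fun y hy => Real.rpow_nonneg (hpos y hy).le _)
    (hui.congr_fun e1 measurableSet_ball) (hd.congr_fun e2 measurableSet_ball)
  rw [← setIntegral_congr_fun measurableSet_ball e1, ← setIntegral_congr_fun measurableSet_ball e2,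
    setIntegral_congr_fun measurableSet_ball e3] at h2
  have h3 : ∀ y ∈ ball (0 : EuclideanSpace ℝ (Fin N)) 1, 0 ≤ (u y / (1 - ‖y‖)) ^ (1 / 3 : ℝ) :=
    fun y hy => Real.rpow_nonneg (div_nonneg (hu0 y hy) (hpos y hy).le) _
  have h4 := setIntegral_mono_set (IntegrableOn.congr_fun h1 e3 measurableSet_ball)
    (ae_restrict_of_forall_mem measurableSet_ball h3) hS.eventuallyLE
  have h5 : 0 ≤ ∫ y in S, (u y / (1 - ‖y‖)) ^ (1 / 3 : ℝ) :=
    setIntegral_nonneg hSm fun y hy => h3 y (hS hy)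
  have hI : 0 ≤ ∫ y in ball (0 : EuclideanSpace ℝ (Fin N)) 1, u y :=
    setIntegral_nonneg measurableSet_ball hu0
  calc _ ≤ ((∫ y in ball (0 : EuclideanSpace ℝ (Fin N)) 1, u y) ^ (1 / 3 : ℝ) *
        J ^ (1 / (3 / 2) : ℝ)) ^ (1 / (1 / 3) : ℝ) :=
        Real.rpow_le_rpow h5 (h4.trans h2) (by norm_num)
    _ = J ^ 2 * ∫ y in ball (0 : EuclideanSpace ℝ (Fin N)) 1, u y := by
        rw [Real.mul_rpow (by positivity) (by positivity), ← Real.rpow_mul hI,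
          ← Real.rpow_mul hJ0, ← Real.rpow_natCast]
        norm_num
        ring
    _ ≤ _ := by gcongr; linarith

/-- Integral of a nonnegative supersolution over a smaller ball, bounded by its value at `x`. -/
lemma exists_forall_setIntegral_le {N : ℕ} (hN : 2 ≤ N) {K : ℝ} (hK : 0 ≤ K) :
    ∃ A B : ℝ, 0 ≤ A ∧ 0 ≤ B ∧ ∀ u g : EuclideanSpace ℝ (Fin N) → ℝ,
      ContDiffOn ℝ 2 u (ball 0 1) → (∀ y ∈ ball 0 1, 0 ≤ u y) → (∀ y, 0 ≤ g y) →
      (∀ y ∈ ball 0 1, lap u y ≤ K * u y + g y) →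
      ∀ x ∈ ball (0 : EuclideanSpace ℝ (Fin N)) 1,
        IntegrableOn (fun y => ‖y - x‖ ^ (1 - (N : ℝ)) * g y) (ball 0 1) →
        ∀ r < 1, (1 - ‖x‖ ^ 2) * ∫ y in ball (0 : EuclideanSpace ℝ (Fin N)) r, u y ≤
          A * u x + B * (1 - ‖x‖ ^ 2) *
            ∫ y in ball (0 : EuclideanSpace ℝ (Fin N)) 1, ‖y - x‖ ^ (1 - (N : ℝ)) * g y := by
  have hN2 : (2 : ℝ) ≤ N := by exact_mod_cast hN
  have : Nonempty (Fin N) := ⟨⟨0, by omega⟩⟩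
  obtain ⟨C, hC, hCk⟩ := exists_forall_integral_kernel_le (N := N)
  set n : ℝ := (N : ℝ) / 2 with hn
  have hl : 0 < K + 1 := by linarith
  set c : ℝ := 4 * profileExcess n (K + 1) 5 with hc
  have hc0 : 0 < c := by
    have := profileExcess_pos (n := n) hl (show (0 : ℝ) < 5 by norm_num)
    positivity
  refine ⟨8 * (n + 1) * C / c, 8 / c, by positivity, by positivity,
    fun u g hu hu0 hg0 hlap x hx hgi r hr => ?_⟩
  have hx1 : ‖x‖ < 1 := by simpa using hx
  set D : ℝ := 1 - ‖x‖ ^ 2 with hD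
  have hD0 : 0 < D := by rw [hD]; nlinarith [norm_nonneg x]
  set G := ∫ y in ball (0 : EuclideanSpace ℝ (Fin N)) 1, ‖y - x‖ ^ (1 - (N : ℝ)) * g y with hG
  have key : ∀ e > 0, c * D / 2 * ∫ y in ball (0 : EuclideanSpace ℝ (Fin N)) r, u y ≤
      4 * (n + 1) * C * (u x + e) + 4 * D * G := by
    intro e he
    obtain ⟨δ, hδ, hδu⟩ : ∃ δ > 0, ∀ y, ‖y - x‖ < δ → u y ≤ u x + e := by
      have h1 := (hu.continuousOn.continuousAt (isOpen_ball.mem_nhds hx)).eventually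
        (gt_mem_nhds (show u x < u x + e by linarith))
      obtain ⟨δ, hδ, h2⟩ := Metric.eventually_nhds_iff.1 h1
      exact ⟨δ, hδ, fun y hy => (h2 (by rwa [dist_eq_norm])).le⟩
    obtain ⟨ρ, hρ, hρ1, hρδ⟩ : ∃ ρ > 0, ρ ≤ 1 ∧
        4 * ρ * ((n + 1) * (δ ^ 2) ^ (-n - 1)) ≤ c * D / 2 := by
      set m := 4 * ((n + 1) * (δ ^ 2) ^ (-n - 1)) with hm
      have hm0 : 0 < m := by positivity
      refine ⟨min 1 (c * D / 2 / m), lt_min one_pos (by positivity), min_le_left _ _, ?_⟩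
      calc _ = min 1 (c * D / 2 / m) * m := by rw [hm]; ring
        _ ≤ c * D / 2 / m * m := by gcongr; exact min_le_right _ _
        _ = _ := by field_simp
    set P : EuclideanSpace ℝ (Fin N) → ℝ :=
      fun y => 4 * ρ * ((n + 1) * (‖y - x‖ ^ 2 + ρ) ^ (-n - 1)) with hP
    have hP0 : ∀ y, 0 ≤ P y := fun y => by simp only [hP]; positivity
    have hPeq : P = fun y => 4 * (n + 1) * (ρ * (‖y - x‖ ^ 2 + ρ) ^ (-n - 1)) := by
      funext y; simp only [hP]; ring
    obtain ⟨hk1, hk2⟩ := hCk ρ hρ x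
    have hPi : Integrable P := by rw [hPeq]; exact hk1.const_mul _
    have hPC : ∫ y, P y ≤ 4 * (n + 1) * C := by
      rw [hPeq, integral_const_mul]; gcongr
    have hPδ : ∀ y, δ ≤ ‖y - x‖ → P y ≤ c * D / 2 := by
      intro y hy
      refine le_trans ?_ hρδ
      simp only [hP]
      gcongr 4 * ρ * ((n + 1) * ?_)
      apply Real.rpow_le_rpow_of_nonpos (by positivity) _ (by linarith)
      nlinarith
    set s := max r 0 with hs
    have hs1 : s < 1 := max_lt hr one_pos
    have hs0 : 0 ≤ s := le_max_right _ _
    set η : ℝ := D * (1 - s ^ 2) * profile n (K + 1) 5 / 2 with hη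
    have hpr : 0 < profile n (K + 1) 5 := profile_pos (by norm_num)
    have hη0 : 0 < η := by
      have : 0 < 1 - s ^ 2 := by nlinarith
      positivity
    obtain ⟨ψ, θ, ψ₁, ψ₂, R, hR, h1, h2, hc', hc1, hc2, hz, hz1, hz2, hψ⟩ :=
      exists_test_function hN hl hK (by nlinarith) hρ hρ1 hη0 hx1
    obtain ⟨hGi, hG0⟩ := integral_mul_lap_sub_eq_zero hR hu h1 h2 hc' hc1 hc2 hz hz1 hz2
    have hb : ∀ y : EuclideanSpace ℝ (Fin N), y ∈ ball 0 1 ↔ ‖y‖ < 1 := fun y => by simp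
    have hux : 0 ≤ u x := hu0 x hx
    have hui : IntegrableOn u (ball 0 r) :=
      ((hu.continuousOn.mono (closedBall_subset_ball hr)).integrableOn_compact
        (isCompact_closedBall 0 r)).mono_set ball_subset_closedBall
    have hle : ∀ᵐ y, (ball (0 : EuclideanSpace ℝ (Fin N)) r).indicator
        (fun y => c * D / 2 * u y) y ≤ (u y * ∑ i, ψ₂ i y - ψ y * lap u y) + (u x + e) * P y +
          (ball (0 : EuclideanSpace ℝ (Fin N)) 1).indicator
            (fun y => 4 * D * (‖y - x‖ ^ (1 - (N : ℝ)) * g y)) y := by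
      filter_upwards [Measure.ae_ne volume x] with y hyx
      have hp : 0 ≤ (u x + e) * P y := mul_nonneg (by linarith) (hP0 y)
      by_cases hy : ‖y‖ < 1
      · rw [indicator_of_mem ((hb y).2 hy)]
        have hu0y := hu0 y ((hb y).2 hy)
        have hlapy := hlap y ((hb y).2 hy)
        have hg0y := hg0 y
        obtain ⟨hψ0, hψ1, hθ0, hθ1, hψ2, hψ3⟩ := hψ y hy
        rw [← hn, ← hc, ← hD] at hψ2
        have t1 : ψ y * g y ≤ 4 * D * (‖y - x‖ ^ (1 - (N : ℝ)) * g y) := by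
          have hyx' : 0 < ‖y - x‖ := norm_pos_iff.2 (sub_ne_zero.2 hyx)
          have : (‖y - x‖ ^ 2 + ρ) ^ ((1 : ℝ) / 2 - n) ≤ ‖y - x‖ ^ (1 - (N : ℝ)) := by
            calc _ ≤ (‖y - x‖ ^ 2) ^ ((1 : ℝ) / 2 - n) :=
                  Real.rpow_le_rpow_of_nonpos (by positivity) (by linarith) (by linarith)
              _ = _ := by
                  rw [← Real.rpow_natCast, ← Real.rpow_mul hyx'.le]
                  congr 1
                  rw [hn]; push_cast; ring
          calc ψ y * g y ≤ 4 * D * ‖y - x‖ ^ (1 - (N : ℝ)) * g y := by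
                gcongr; exact hψ1.trans (by gcongr)
            _ = _ := by ring
        have t2 : ψ y * lap u y ≤ ψ y * (K * u y + g y) := by gcongr
        have t3 := mul_le_mul_of_nonneg_left hψ2 hu0y
        have t4 : u y * (θ y * (c * D / 2)) ≤ u y * (θ y * (c * D - P y)) + (u x + e) * P y := by
          rcases lt_or_ge ‖y - x‖ δ with hd | hd
          · have q1 := hδu y hd
            have q2 : u y * θ y * P y ≤ (u x + e) * P y := by
              have := hP0 y
              gcongr
              exact (mul_le_of_le_one_right hu0y hθ1).trans q1
            have q3 : u y * (θ y * (c * D / 2)) ≤ u y * (θ y * (c * D)) := by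
              gcongr; exact half_le_self (by positivity)
            linarith
          · have q1 := hPδ y hd
            have q2 : u y * (θ y * (c * D / 2)) ≤ u y * (θ y * (c * D - P y)) := by
              gcongr; linarith
            linarith
        have t5 : (ball (0 : EuclideanSpace ℝ (Fin N)) r).indicator
            (fun y => c * D / 2 * u y) y ≤ u y * (θ y * (c * D / 2)) := by
          by_cases hyr : y ∈ ball (0 : EuclideanSpace ℝ (Fin N)) r
          · have hys : ‖y‖ ≤ s := by
              have : ‖y‖ < r := by simpa using hyr
              exact this.le.trans (le_max_left _ _)
            rw [indicator_of_mem hyr, hψ3]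
            · linarith
            · rw [hη, ← hD, ← hn, mul_div_cancel₀ _ two_ne_zero]
              gcongr
          · rw [indicator_of_notMem hyr]; positivity
        change u y * (K * ψ y + θ y * (c * D - P y)) ≤ _ at t3
        linarith
      · have hyr : y ∉ ball (0 : EuclideanSpace ℝ (Fin N)) r := by
          simp only [mem_ball, dist_zero_right]; linarith
        have hyR : R < ‖y‖ := by linarith
        rw [indicator_of_notMem hyr, indicator_of_notMem (mt (hb y).1 hy), hz y hyR,
          Finset.sum_eq_zero fun i _ => hz2 i y hyR]
        linarith
    have hGP : Integrable fun y =>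
        (u y * ∑ i, ψ₂ i y - ψ y * lap u y) + (u x + e) * P y :=
      hGi.add (hPi.const_mul (u x + e))
    have hgi' : Integrable ((ball (0 : EuclideanSpace ℝ (Fin N)) 1).indicator
        fun y => 4 * D * (‖y - x‖ ^ (1 - (N : ℝ)) * g y)) :=
      (integrable_indicator_iff measurableSet_ball).2 (hgi.const_mul (4 * D))
    have hint := integral_mono_ae
      ((integrable_indicator_iff measurableSet_ball).2 (hui.const_mul (c * D / 2)))
      (hGP.add hgi') hle
    simp only [Pi.add_apply] at hint
    rw [integral_add hGP hgi', integral_add hGi (hPi.const_mul (u x + e)), hG0,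
      integral_indicator measurableSet_ball,
      integral_indicator measurableSet_ball, integral_const_mul (c * D / 2),
      integral_const_mul (u x + e), integral_const_mul (4 * D), ← hG] at hint
    have : (u x + e) * ∫ y, P y ≤ (u x + e) * (4 * (n + 1) * C) := by gcongr
    linarith
  have key0 : c * D / 2 * ∫ y in ball (0 : EuclideanSpace ℝ (Fin N)) r, u y ≤
      4 * (n + 1) * C * u x + 4 * D * G := by
    have hm : 0 < 4 * (n + 1) * C + 1 := by positivity
    refine le_of_forall_pos_le_add fun e he => ?_
    have h := key (e / (4 * (n + 1) * C + 1)) (by positivity)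
    have h' : 4 * (n + 1) * C * (e / (4 * (n + 1) * C + 1)) ≤ e := by
      rw [mul_div_assoc', div_le_iff₀ hm]; nlinarith
    linarith
  calc _ = 2 / c * (c * D / 2 * ∫ y in ball (0 : EuclideanSpace ℝ (Fin N)) r, u y) := by
        field_simp
    _ ≤ 2 / c * (4 * (n + 1) * C * u x + 4 * D * G) := by gcongr
    _ = _ := by field_simp; ring

lemma exists_forall_integral_le {N : ℕ} (hN : 2 ≤ N) {K : ℝ} (hK : 0 ≤ K) {p : ℝ}
    (hp : (N : ℝ) < p) :
    ∃ A B : ℝ, 0 < A ∧ 0 < B ∧ ∀ u g : EuclideanSpace ℝ (Fin N) → ℝ,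
      ContDiffOn ℝ 2 u (ball 0 1) → (∀ y ∈ ball 0 1, 0 ≤ u y) →
      ContinuousOn g (ball 0 1) → (∀ y, 0 ≤ g y) → IntegrableOn (fun y => g y ^ p) (ball 0 1) →
      (∀ y ∈ ball 0 1, lap u y ≤ K * u y + g y) →
      IntegrableOn u (ball 0 1) ∧ ∀ x ∈ ball (0 : EuclideanSpace ℝ (Fin N)) 1,
        ∫ y in ball (0 : EuclideanSpace ℝ (Fin N)) 1, u y ≤ A * (u x / (1 - ‖x‖)) +
          B * (∫ y in ball (0 : EuclideanSpace ℝ (Fin N)) 1, g y ^ p) ^ (1 / p) := by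
  obtain ⟨A, B, hA, hB, hAB⟩ := exists_forall_setIntegral_le hN hK
  obtain ⟨C, hC, hpot⟩ := exists_forall_integral_potential_le hN hp
  refine ⟨A + 1, B * C + 1, by positivity, by positivity,
    fun u g hu hu0 hg hg0 hgp hlap => ?_⟩
  set L := (∫ y in ball (0 : EuclideanSpace ℝ (Fin N)) 1, g y ^ p) ^ (1 / p) with hL
  have hL0 : 0 ≤ L := Real.rpow_nonneg (integral_nonneg fun y => Real.rpow_nonneg (hg0 y) _) _
  have hbound : ∀ x ∈ ball (0 : EuclideanSpace ℝ (Fin N)) 1, ∀ r < 1,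
      ∫ y in ball (0 : EuclideanSpace ℝ (Fin N)) r, u y ≤
        (A + 1) * (u x / (1 - ‖x‖)) + (B * C + 1) * L := by
    intro x hx r hr
    have hx1 : ‖x‖ < 1 := by simpa using hx
    obtain ⟨hgi, hgl⟩ := hpot g hg hg0 hgp x hx
    have h := hAB u g hu hu0 hg0 hlap x hx hgi r hr
    have hd : 0 < 1 - ‖x‖ := by linarith
    have hD : 1 - ‖x‖ ≤ 1 - ‖x‖ ^ 2 := by nlinarith [norm_nonneg x]
    have hux := hu0 x hx
    set D := 1 - ‖x‖ ^ 2
    have hD0 : 0 < D := hd.trans_le hD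
    have h' : ∫ y in ball (0 : EuclideanSpace ℝ (Fin N)) r, u y ≤ A * (u x / D) + B * C * L := by
      refine le_of_mul_le_mul_left (h.trans ?_) hD0
      calc _ ≤ A * u x + B * D * (C * L) := by gcongr
        _ = _ := by field_simp
    refine h'.trans ?_
    have : u x / D ≤ u x / (1 - ‖x‖) := by gcongr
    gcongr <;> linarith
  have hcov : AECover (volume.restrict (ball (0 : EuclideanSpace ℝ (Fin N)) 1)) Filter.atTop
      fun k : ℕ => ball (0 : EuclideanSpace ℝ (Fin N)) (1 - 1 / ((k : ℝ) + 1)) := by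
    refine ⟨ae_restrict_of_forall_mem measurableSet_ball fun y hy => ?_,
      fun _ => measurableSet_ball⟩
    have h1 : Filter.Tendsto (fun k : ℕ => 1 - 1 / ((k : ℝ) + 1)) Filter.atTop (nhds (1 - 0)) :=
      tendsto_const_nhds.sub tendsto_one_div_add_atTop_nhds_zero_nat
    rw [sub_zero] at h1
    exact h1.eventually (lt_mem_nhds hy)
  have hr : ∀ k : ℕ, 1 - 1 / ((k : ℝ) + 1) < 1 := fun k => by
    have : (0 : ℝ) < 1 / ((k : ℝ) + 1) := by positivity
    linarith
  have hrestr : ∀ k : ℕ, (volume.restrict (ball (0 : EuclideanSpace ℝ (Fin N)) 1)).restrict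
      (ball 0 (1 - 1 / ((k : ℝ) + 1))) = volume.restrict (ball 0 (1 - 1 / ((k : ℝ) + 1))) :=
    fun k => Measure.restrict_restrict_of_subset (ball_subset_ball (hr k).le)
  have hui : IntegrableOn u (ball 0 1) := by
    refine hcov.integrable_of_integral_bounded_of_nonneg_ae
      ((A + 1) * (u 0 / (1 - ‖(0 : EuclideanSpace ℝ (Fin N))‖)) + (B * C + 1) * L)
      (fun k => ?_) (ae_restrict_of_forall_mem measurableSet_ball hu0)
      (Filter.Eventually.of_forall fun k => ?_)
    · rw [IntegrableOn, hrestr]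
      exact ((hu.continuousOn.mono (closedBall_subset_ball (hr k))).integrableOn_compact
        (isCompact_closedBall 0 _)).mono_set ball_subset_closedBall
    · rw [hrestr]
      exact hbound 0 (mem_ball_self one_pos) _ (hr k)
  refine ⟨hui, fun x hx => ?_⟩
  refine le_of_tendsto' (hcov.integral_tendsto_of_countably_generated hui) fun k => ?_
  rw [hrestr]
  exact hbound x hx _ (hr k)

/-- Boundary weak Harnack inequality with right-hand side (Corollary 3.8) on the
unit ball: for `u ≥ 0` with `-Δu + a u ≥ b`, `0 ≤ a ≤ K`, `b⁻ ∈ L^p`, `p > N`. -/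
theorem stmt_10 {N : ℕ} (hN : 2 ≤ N) (K : ℝ) (hK : 0 ≤ K) (p : ℝ) (hp : (N : ℝ) < p) :
    ∃ Rbar ε C₁ C₂ : ℝ, 0 < Rbar ∧ 0 < ε ∧ 0 < C₁ ∧ 0 < C₂ ∧
      ∀ a b u : EuclideanSpace ℝ (Fin N) → ℝ,
        ContinuousOn a (ball (0 : EuclideanSpace ℝ (Fin N)) 1) →
        (∀ x ∈ ball (0 : EuclideanSpace ℝ (Fin N)) 1, 0 ≤ a x ∧ a x ≤ K) →
        ContinuousOn b (ball (0 : EuclideanSpace ℝ (Fin N)) 1) →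
        IntegrableOn (fun x => max (-b x) 0 ^ p) (ball (0 : EuclideanSpace ℝ (Fin N)) 1) →
        ContDiffOn ℝ 2 u (ball (0 : EuclideanSpace ℝ (Fin N)) 1) →
        (∀ x ∈ ball (0 : EuclideanSpace ℝ (Fin N)) 1, 0 ≤ u x) →
        (∀ x ∈ ball (0 : EuclideanSpace ℝ (Fin N)) 1, b x ≤ -lap u x + a x * u x) →
        ∀ x₀ ∈ sphere (0 : EuclideanSpace ℝ (Fin N)) 1, ∀ R ∈ Ioc (0 : ℝ) Rbar,
          ∀ x ∈ ball x₀ R ∩ ball (0 : EuclideanSpace ℝ (Fin N)) 1,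
            C₁ * (∫ y in ball x₀ R ∩ ball (0 : EuclideanSpace ℝ (Fin N)) 1,
                    (u y / (1 - ‖y‖)) ^ ε) ^ (1 / ε)
              - C₂ * (∫ y in ball (0 : EuclideanSpace ℝ (Fin N)) 1,
                    max (-b y) 0 ^ p) ^ (1 / p)
              ≤ u x / (1 - ‖x‖) := by

  obtain ⟨A, B, hA, hB, hAB⟩ := exists_forall_integral_le hN hK hp
  obtain ⟨C, hC, hCd⟩ := exists_forall_integral_div_rpow_le (N := N) (by omega)
  refine ⟨1, 1 / 3, 1 / (A * C), B / A, one_pos, by norm_num, by positivity, by positivity,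
    fun a b u _ ha hb hbp hu hu0 hbu x₀ _ R _ x hx => ?_⟩
  obtain ⟨hui, hI⟩ := hAB u (fun y => max (-b y) 0) hu hu0
    (hb.neg.sup continuousOn_const) (fun y => le_max_right _ _) hbp (fun y hy => by
      have h1 := hbu y hy
      have h2 := mul_le_mul_of_nonneg_right (ha y hy).2 (hu0 y hy)
      have h3 := le_max_left (-b y) 0
      linarith)
  have h1 := hCd u hu.continuousOn hu0 hui (ball x₀ R ∩ ball 0 1) inter_subset_right
    (measurableSet_ball.inter measurableSet_ball)
  have h2 := h1.trans (mul_le_mul_of_nonneg_left (hI x hx.2) hC.le)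
  have h3 := mul_le_mul_of_nonneg_left h2 (show 0 ≤ 1 / (A * C) by positivity)
  rw [sub_le_iff_le_add]
  refine h3.trans_eq ?_
  field_simp
end
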